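/- arXiv:1208.1203 — 5 statements merged into one kernel-verified Lean document; each statement's English description precedes it below -/
import Mathlib

section
/- Let f ∈ C[0,∞) ∩ C^∞(0,∞) be completely monotone, i.e. (−1)^k f^{(k)}(t) ≥ 0 for all integers k ≥ 0 and all t > 0. Then for every n ∈ ℕ the function x ↦ f(|x|) is positive definite on ℝ^n. -/
open MeasureTheory Filter
open scoped ComplexOrder ENNReal RealInnerProductSpace

noncomputable section

/-- The Hilbert space `ℓ²(ℕ)` of square-summable complex sequences. -/
abbrev ell2 : Type := lp (fun _ : ℕ => ℂ) 2

/-- The standard basis vector `e k` of `ℓ²(ℕ)`. -/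
def stdBasis (k : ℕ) : ell2 := lp.single 2 k (1 : ℂ)

/-- A sequence in a normed space is a *Riesz–Fischer sequence* if there is `c > 0` with
`‖∑_{k<m} ξ_k f_k‖² ≥ c ∑_{k<m} |ξ_k|²` for all `m` and all coefficients `ξ`. -/
def IsRieszFischerSeq {F : Type*} [NormedAddCommGroup F] [NormedSpace ℂ F] (f : ℕ → F) : Prop :=
  ∃ c : ℝ, 0 < c ∧ ∀ (m : ℕ) (ξ : Fin m → ℂ),
    c * ∑ k, ‖ξ k‖ ^ 2 ≤ ‖∑ k, ξ k • f (k : ℕ)‖ ^ 2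

/-- A sequence in a normed space is a *Bessel sequence* if there is `C > 0` with
`‖∑_{k<m} ξ_k f_k‖² ≤ C ∑_{k<m} |ξ_k|²` for all `m` and all coefficients `ξ`. -/
def IsBesselSeq {F : Type*} [NormedAddCommGroup F] [NormedSpace ℂ F] (f : ℕ → F) : Prop :=
  ∃ C : ℝ, 0 < C ∧ ∀ (m : ℕ) (ξ : Fin m → ℂ),
    ‖∑ k, ξ k • f (k : ℕ)‖ ^ 2 ≤ C * ∑ k, ‖ξ k‖ ^ 2

/-- `g` is *strongly `X`-positive definite*: there is `c > 0` such that for every finite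
choice of distinct points from (the range of) `X` and all complex coefficients `ξ`,
`∑_{j,k} ξ_k conj(ξ_j) g(y_k − y_j) ≥ c ∑_k |ξ_k|²` (inequality in the complex order). -/
def IsStronglyPosDef {E : Type*} [NormedAddCommGroup E] (X : ℕ → E) (g : E → ℂ) : Prop :=
  ∃ c : ℝ, 0 < c ∧ ∀ (m : ℕ) (y : Fin m → E),
    (∀ i, y i ∈ Set.range X) → Function.Injective y → ∀ ξ : Fin m → ℂ,
      ((c * ∑ k, ‖ξ k‖ ^ 2 : ℝ) : ℂ) ≤ ∑ j, ∑ k, ξ k * (starRingEnd ℂ) (ξ j) * g (y k - y j)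

/-- `g` is a *positive definite function*: it is continuous at `0` and all quadratic forms
`∑_{j,k} ξ_k conj(ξ_j) g(x_k − x_j)` are nonnegative (in the complex order). -/
def IsPosDefFn {E : Type*} [NormedAddCommGroup E] (g : E → ℂ) : Prop :=
  ContinuousAt g 0 ∧ ∀ (m : ℕ) (x : Fin m → E) (ξ : Fin m → ℂ),
    (0 : ℂ)≤ ∑ j, ∑ k, ξ k * (starRingEnd ℂ) (ξ j) * g (x k - x j)

/-- `d_*(X) > 0`: the points of the sequence `X` are uniformly separated. -/
def SeparatedSeq {E : Type*} [MetricSpace E] (X : ℕ → E) : Prop :=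
  ∃ d : ℝ, 0 < d ∧ ∀ k j, k ≠ j → d ≤ dist (X k) (X j)

/-- The upper density `D*(Λ)` of a real sequence: the (limsup form of the) limit of
`n(r)/r`, where `n(r)` is the largest number of terms of `Λ` lying in an interval
of length `r`. -/
def upperDensity (Λ : ℕ → ℝ) : ℝ≥0∞ :=
  Filter.limsup (fun r : ℝ =>
    (⨆ a : ℝ, ∑' _ : {k : ℕ // Λ k ∈ Set.Icc a (a + r)}, (1 : ℝ≥0∞)) / ENNReal.ofReal r)
    Filter.atTop


open Polynomial Topology

/-- Complete monotonicity up to order `k` on `(0,∞)`, in recursive form. -/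
def CMk : ℕ → (ℝ → ℝ) → Prop
  | 0, f => ∀ t : ℝ, 0 < t → 0 ≤ f t
  | k + 1, f => (∀ t : ℝ, 0 < t → 0 ≤ f t) ∧
      ∃ g : ℝ → ℝ, CMk k g ∧ ∀ t : ℝ, 0 < t → HasDerivAt f (-g t) t

lemma CMk.nonneg {k : ℕ} {f : ℝ → ℝ} (h : CMk k f) : ∀ t : ℝ, 0 < t → 0 ≤ f t := by
  cases k with
  | zero => exact h
  | succ k => exact h.1

lemma CMk.of_succ {k : ℕ} : ∀ {f : ℝ → ℝ}, CMk (k + 1) f → CMk k f := by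
  induction k with
  | zero => intro f h; exact h.1
  | succ k ih =>
    rintro f ⟨h0, g, hg, hd⟩
    exact ⟨h0, g, ih hg, hd⟩

lemma CMk.add {k : ℕ} : ∀ {f g : ℝ → ℝ}, CMk k f → CMk k g → CMk k (fun t => f t + g t) := by
  induction k with
  | zero => intro f g hf hg t ht; exact add_nonneg (hf t ht) (hg t ht)
  | succ k ih =>
    rintro f g ⟨hf, f', hf', hfd⟩ ⟨hg, g', hg', hgd⟩
    refine ⟨fun t ht => add_nonneg (hf t ht) (hg t ht), _, ih hf' hg', fun t ht => ?_⟩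
    exact ((hfd t ht).add (hgd t ht)).congr_deriv (by ring)

lemma CMk.mul {k : ℕ} : ∀ {f g : ℝ → ℝ}, CMk k f → CMk k g → CMk k (fun t => f t * g t) := by
  induction k with
  | zero => intro f g hf hg t ht; exact mul_nonneg (hf t ht) (hg t ht)
  | succ k ih =>
    intro f g hF hG
    obtain ⟨hf, f', hf', hfd⟩ := id hF
    obtain ⟨hg, g', hg', hgd⟩ := id hG
    refine ⟨fun t ht => mul_nonneg (hf t ht) (hg t ht), _,
      (ih hf' hG.of_succ).add (ih hF.of_succ hg'), fun t ht => ?_⟩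
    exact ((hfd t ht).mul (hgd t ht)).congr_deriv (by ring)

lemma CMk.rpow (k : ℕ) : ∀ (c p : ℝ), 0 ≤ c → 0 < p → CMk k (fun t => c * t ^ (-p)) := by
  induction k with
  | zero => intro c p hc hp t ht; positivity
  | succ k ih =>
    intro c p hc hp
    refine ⟨fun t ht => by positivity, _, ih (c * p) (p + 1) (by positivity) (by positivity),
      fun t ht => ?_⟩
    refine ((Real.hasDerivAt_rpow_const (p := -p) (Or.inl ht.ne')).const_mul c).congr_deriv ?_
    rw [show -p - 1 = -(p + 1) by ring]
    ring

lemma CMk.sqrt {k : ℕ} : ∀ {f : ℝ → ℝ}, CMk k f → CMk k (fun t => f (Real.sqrt t)) := by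
  induction k with
  | zero => intro f hf t ht; exact hf _ (Real.sqrt_pos.2 ht)
  | succ k ih =>
    rintro f ⟨hf, g, hg, hd⟩
    refine ⟨fun t ht => hf _ (Real.sqrt_pos.2 ht), _,
      (ih hg).mul (CMk.rpow k (1/2) (1/2) (by norm_num) (by norm_num)), fun t ht => ?_⟩
    refine ((hd _ (Real.sqrt_pos.2 ht)).comp t (Real.hasDerivAt_sqrt ht.ne')).congr_deriv ?_
    rw [Real.rpow_neg ht.le, ← Real.sqrt_eq_rpow]
    field_simp

lemma CMk.antitone {k : ℕ} {f : ℝ → ℝ} (h : CMk (k + 1) f) : AntitoneOn f (Set.Ioi 0) := by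
  obtain ⟨_, g, hg, hd⟩ := h
  refine antitoneOn_of_deriv_nonpos (convex_Ioi 0)
    (fun t ht => (hd t ht).continuousAt.continuousWithinAt)
    (fun t ht => ?_) (fun t ht => ?_)
  · rw [interior_Ioi] at ht
    exact (hd t ht).differentiableAt.differentiableWithinAt
  · rw [interior_Ioi] at ht
    rw [(hd t ht).deriv]
    linarith [hg.nonneg t ht]

lemma CMk.diff {h : ℝ} (hh : 0 < h) {k : ℕ} :
    ∀ {f : ℝ → ℝ}, CMk (k + 1) f → CMk k (fun t => f t - f (t + h)) := by
  induction k with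
  | zero =>
    intro f hf t ht
    have := hf.antitone (Set.mem_Ioi.2 ht) (Set.mem_Ioi.2 (by linarith : 0 < t + h)) (by linarith)
    simpa using this
  | succ k ih =>
    intro f hf
    obtain ⟨hf0, g, hg, hd⟩ := id hf
    refine ⟨fun t ht => ?_, _, ih hg, fun t ht => ?_⟩
    · have := hf.antitone (Set.mem_Ioi.2 ht) (Set.mem_Ioi.2 (by linarith : 0 < t + h)) (by linarith)
      simpa using this
    · exact ((hd t ht).sub ((hd (t + h) (by linarith)).comp_add_const t h)).congr_deriv (by ring)

/-- The moment functional `X^j ↦ f (ε + j h)`. -/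
def momL (f : ℝ → ℝ) (ε h : ℝ) : ℝ[X] →ₗ[ℝ] ℝ :=
  Polynomial.lsum (fun j => (f (ε + j * h)) • LinearMap.id)

lemma momL_monomial (f : ℝ → ℝ) (ε h : ℝ) (j : ℕ) (c : ℝ) :
    momL f ε h (monomial j c) = f (ε + j * h) * c := by
  simp [momL, Polynomial.lsum_apply, Polynomial.sum_monomial_index]

lemma momL_X_pow (f : ℝ → ℝ) (ε h : ℝ) (j : ℕ) :
    momL f ε h (X ^ j) = f (ε + j * h) := by
  rw [← monomial_one_right_eq_X_pow, momL_monomial, mul_one]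

lemma momL_diff (f : ℝ → ℝ) (ε h : ℝ) (p : ℝ[X]) :
    momL f ε h (p * (1 - X)) = momL (fun t => f t - f (t + h)) ε h p := by
  induction p using Polynomial.induction_on' with
  | add p q hp hq => rw [add_mul, map_add, map_add, hp, hq]
  | monomial j c =>
    rw [mul_sub, mul_one, map_sub, monomial_mul_X, momL_monomial, momL_monomial, momL_monomial]
    push_cast
    ring_nf

lemma momL_nonneg {ε h : ℝ} (hε : 0 < ε) (hh : 0 < h) (l : ℕ) :
    ∀ {f : ℝ → ℝ}, CMk l f → ∀ m : ℕ, 0 ≤ momL f ε h (X ^ m * (1 - X) ^ l) := by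
  induction l with
  | zero =>
    intro f hf m
    rw [pow_zero, mul_one, momL_X_pow]
    exact hf _ (by positivity)
  | succ l ih =>
    intro f hf m
    rw [pow_succ, ← mul_assoc, momL_diff]
    exact ih (hf.diff hh) m

/-- Bernstein operator on monomials. -/
def bernX (N j : ℕ) : ℝ[X] :=
  ∑ m ∈ Finset.range (N + 1), (((m : ℝ) / N) ^ j) • bernsteinPolynomial ℝ N m

lemma X_mul_deriv_pow (m : ℕ) : (X : ℝ[X]) * derivative (X ^ m) = (m : ℝ[X]) * X ^ m := by
  cases m with
  | zero => simp
  | succ m =>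
    rw [derivative_X_pow, Nat.add_sub_cancel, pow_succ]
    simp only [map_natCast]
    ring

lemma one_sub_X_mul_deriv_pow (m : ℕ) :
    (1 - X : ℝ[X]) * derivative ((1 - X) ^ m) = -(m : ℝ[X]) * (1 - X) ^ m := by
  cases m with
  | zero => simp
  | succ m =>
    rw [derivative_pow, Nat.add_sub_cancel, pow_succ]
    simp only [map_natCast, derivative_sub, derivative_one, derivative_X]
    ring

lemma bern_deriv (N m : ℕ) (hm : m ≤ N) :
    X * (1 - X) * derivative (bernsteinPolynomial ℝ N m) =
      ((m : ℝ[X]) - (N : ℝ[X]) * X) * bernsteinPolynomial ℝ N m := by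
  have h1 := X_mul_deriv_pow m
  have h2 := one_sub_X_mul_deriv_pow (N - m)
  rw [Nat.cast_sub hm] at h2
  simp only [bernsteinPolynomial, derivative_mul, derivative_natCast, zero_mul, zero_add]
  linear_combination ((N.choose m : ℝ[X]) * (1 - X) * (1 - X) ^ (N - m)) * h1 +
    ((N.choose m : ℝ[X]) * X * X ^ m) * h2

lemma bernX_succ (N j : ℕ) (hN : N ≠ 0) :
    bernX N (j + 1) = X * bernX N j + (1 / (N : ℝ)) • (X * (1 - X) * derivative (bernX N j)) := by
  have hN' : (N : ℝ) ≠ 0 := by exact_mod_cast hN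
  simp only [bernX, derivative_sum, Finset.mul_sum, Finset.smul_sum, ← Finset.sum_add_distrib]
  refine Finset.sum_congr rfl fun m hm => ?_
  have hm' : m ≤ N := by simpa [Nat.lt_succ_iff] using hm
  rw [derivative_smul, mul_smul_comm, mul_smul_comm, bern_deriv N m hm']
  simp only [smul_eq_C_mul]
  have e1 : (N : ℝ[X]) = C (N : ℝ) := by simp
  have e2 : (m : ℝ[X]) = C (m : ℝ) := by simp
  have e3 : C ((m : ℝ) / N) = C (1 / (N : ℝ)) * C (m : ℝ) := by rw [← C_mul]; congr 1; ring
  have e4 : C (1 / (N : ℝ)) * C (N : ℝ) = 1 := by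
    rw [← C_mul, one_div, inv_mul_cancel₀ hN', C_1]
  rw [e1, e2, C_pow, C_pow, e3]
  linear_combination (X * (C (1 / (N : ℝ)) * C (m : ℝ)) ^ j * bernsteinPolynomial ℝ N m) * e4

lemma bernX_tendsto (j : ℕ) : ∀ L : ℝ[X] →ₗ[ℝ] ℝ,
    Tendsto (fun N => L (bernX N j)) atTop (𝓝 (L (X ^ j))) := by
  induction j with
  | zero =>
    intro L
    have : ∀ N, bernX N 0 = 1 := fun N => by
      simp only [bernX, pow_zero, one_smul]; exact bernsteinPolynomial.sum ℝ N
    simp [this]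
  | succ j ih =>
    intro L
    have h1 := ih (L ∘ₗ LinearMap.mulLeft ℝ (X : ℝ[X]))
    have h2 := ih (L ∘ₗ LinearMap.mulLeft ℝ (X * (1 - X) : ℝ[X]) ∘ₗ derivative)
    have h3 := h1.add ((tendsto_one_div_atTop_nhds_zero_nat (𝕜 := ℝ)).mul h2)
    rw [zero_mul, add_zero] at h3
    have e : (L ∘ₗ LinearMap.mulLeft ℝ (X : ℝ[X])) (X ^ j) = L (X ^ (j + 1)) := by
      simp [pow_succ']
    rw [e] at h3
    refine h3.congr' ?_
    filter_upwards [eventually_ne_atTop 0] with N hN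
    rw [bernX_succ N j hN, map_add, map_smul, smul_eq_mul]
    rfl

/-- Hausdorff positivity. -/
lemma hausdorff_pos {g : ℝ → ℝ} (hg : ∀ k, CMk k g) {ε h : ℝ} (hε : 0 < ε) (hh : 0 < h)
    {ι : Type*} (s : Finset ι) (c : ι → ℝ) (e : ι → ℕ)
    (hP : ∀ y : ℝ, 0 ≤ y → y ≤ 1 → 0 ≤ ∑ i ∈ s, c i * y ^ e i) :
    0 ≤ ∑ i ∈ s, c i * g (ε + e i * h) := by
  have ht : Tendsto (fun N => ∑ i ∈ s, c i * momL g ε h (bernX N (e i))) atTop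
      (𝓝 (∑ i ∈ s, c i * g (ε + e i * h))) := by
    refine tendsto_finsetSum _ fun i _ => ?_
    have := bernX_tendsto (e i) (momL g ε h)
    rw [momL_X_pow] at this
    exact this.const_mul _
  refine ge_of_tendsto' ht fun N => ?_
  have : ∑ i ∈ s, c i * momL g ε h (bernX N (e i)) =
      ∑ m ∈ Finset.range (N + 1), (∑ i ∈ s, c i * ((m : ℝ) / N) ^ e i) *
        momL g ε h (bernsteinPolynomial ℝ N m) := by
    simp only [bernX, map_sum, map_smul, smul_eq_mul, Finset.mul_sum, Finset.sum_mul]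
    rw [Finset.sum_comm]
    simp only [mul_assoc]
  rw [this]
  refine Finset.sum_nonneg fun m hm => mul_nonneg (hP _ (by positivity) ?_) ?_
  · have hm' : m ≤ N := by simpa [Nat.lt_succ_iff] using hm
    exact div_le_one_of_le₀ (by exact_mod_cast hm') (by positivity)
  have e : bernsteinPolynomial ℝ N m = (N.choose m : ℝ) • (X ^ m * (1 - X) ^ (N - m)) := by
    rw [bernsteinPolynomial, smul_eq_C_mul, mul_assoc]; simp
  rw [e, map_smul, smul_eq_mul]
  exact mul_nonneg (by positivity) (momL_nonneg hε hh _ (hg _) m)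


lemma pow_pd {m n : ℕ} (u : Fin m → Fin n → ℝ) (a : Fin m → ℝ) (p : ℕ) :
    0 ≤ ∑ j, ∑ k, a k * a j * (∑ i, u k i * u j i) ^ p := by
  have : ∑ j, ∑ k, a k * a j * (∑ i, u k i * u j i) ^ p =
      ∑ q : Fin p → Fin n, (∑ k, a k * ∏ i, u k (q i)) ^ 2 := by
    have h1 : ∀ j k : Fin m, a k * a j * (∑ i, u k i * u j i) ^ p =
        ∑ q : Fin p → Fin n, (a j * ∏ i, u j (q i)) * (a k * ∏ i, u k (q i)) := by
      intro j k
      rw [Fintype.sum_pow, Finset.mul_sum]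
      refine Finset.sum_congr rfl fun q _ => ?_
      rw [Finset.prod_mul_distrib]
      ring
    simp only [h1]
    have h2 : ∀ q : Fin p → Fin n, (∑ k, a k * ∏ i, u k (q i)) ^ 2 =
        ∑ j, ∑ k, (a j * ∏ i, u j (q i)) * (a k * ∏ i, u k (q i)) := by
      intro q
      rw [sq, Finset.sum_mul_sum]
    simp only [h2]
    rw [Finset.sum_comm (s := (Finset.univ : Finset (Fin p → Fin n)))]
    exact Finset.sum_congr rfl fun j _ => Finset.sum_comm
  rw [this]
  positivity

lemma exp_pd {m n : ℕ} (u : Fin m → Fin n → ℝ) (a : Fin m → ℝ) {c : ℝ} (hc : 0 ≤ c) :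
    0 ≤ ∑ j, ∑ k, a k * a j * Real.exp (c * ∑ i, u k i * u j i) := by
  have hs : HasSum (fun p : ℕ => ∑ j, ∑ k, a k * a j *
      ((c * ∑ i, u k i * u j i) ^ p / (p.factorial : ℝ)))
      (∑ j, ∑ k, a k * a j * Real.exp (c * ∑ i, u k i * u j i)) := by
    refine hasSum_sum fun j _ => hasSum_sum fun k _ => ?_
    have h := NormedSpace.expSeries_div_hasSum_exp (𝔸 := ℝ) (c * ∑ i, u k i * u j i)
    rw [← Real.exp_eq_exp_ℝ] at h
    exact h.mul_left (a k * a j)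
  refine hs.nonneg fun p => ?_
  have : ∑ j, ∑ k, a k * a j * ((c * ∑ i, u k i * u j i) ^ p / (p.factorial : ℝ)) =
      (c ^ p / (p.factorial : ℝ)) * ∑ j, ∑ k, a k * a j * (∑ i, u k i * u j i) ^ p := by
    simp only [Finset.mul_sum (ι := Fin m)]
    refine Finset.sum_congr rfl fun j _ => Finset.sum_congr rfl fun k _ => ?_
    rw [mul_pow]; ring
  rw [this]
  exact mul_nonneg (by positivity) (pow_pd u a p)

lemma gauss_pd {m n : ℕ} (u : Fin m → Fin n → ℝ) (a : Fin m → ℝ) {s : ℝ} (hs : 0 ≤ s) :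
    0 ≤ ∑ j, ∑ k, a k * a j * Real.exp (-s * ∑ i, (u k i - u j i) ^ 2) := by
  have := exp_pd u (fun k => a k * Real.exp (-s * ∑ i, u k i ^ 2)) (c := 2 * s) (by positivity)
  refine this.trans_eq (Finset.sum_congr rfl fun j _ => Finset.sum_congr rfl fun k _ => ?_)
  have e : -s * ∑ i, (u k i - u j i) ^ 2 = -s * ∑ i, u k i ^ 2 + -s * ∑ i, u j i ^ 2 +
      2 * s * ∑ i, u k i * u j i := by
    simp only [Finset.mul_sum, ← Finset.sum_add_distrib]
    exact Finset.sum_congr rfl fun i _ => by ring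
  rw [e, Real.exp_add, Real.exp_add]
  ring

/-- Squared distance of lattice points. -/
def sqd {n : ℕ} (z w : Fin n → ℤ) : ℕ := ∑ i, (z i - w i).natAbs ^ 2

lemma sqd_cast {n : ℕ} (z w : Fin n → ℤ) :
    (sqd z w : ℝ) = ∑ i, ((z i : ℝ) - w i) ^ 2 := by
  simp [sqd, Nat.cast_natAbs, sq_abs]

lemma lattice_pd {m n : ℕ} (z : Fin m → Fin n → ℤ) (a : Fin m → ℝ) (y : ℝ) (h0 : 0 ≤ y)
    (h1 : y ≤ 1) : 0 ≤ ∑ j, ∑ k, a k * a j * y ^ sqd (z k) (z j) := by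
  have key : ∀ y : ℝ, 0 < y → y ≤ 1 → 0 ≤ ∑ j, ∑ k, a k * a j * y ^ sqd (z k) (z j) := by
    intro y h0 h1
    have := gauss_pd (fun k i => (z k i : ℝ)) a (s := -Real.log y)
      (by linarith [Real.log_nonpos h0.le h1])
    convert this using 6 with j _ k _
    rw [← sqd_cast, neg_neg, mul_comm, Real.exp_nat_mul, Real.exp_log h0]
  rcases h0.eq_or_lt with rfl | h0
  · have hc : Continuous fun y : ℝ => ∑ j, ∑ k, a k * a j * y ^ sqd (z k) (z j) := by fun_prop
    have ht := (hc.tendsto 0).comp (tendsto_one_div_add_atTop_nhds_zero_nat (𝕜 := ℝ))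
    refine ge_of_tendsto' ht fun N => key _ (by positivity) ?_
    exact div_le_one_of_le₀ (by linarith [(Nat.cast_nonneg N : (0 : ℝ) ≤ N)]) (by positivity)
  · exact key y h0 h1

lemma lattice_cm {g : ℝ → ℝ} (hg : ∀ k, CMk k g) {ε h : ℝ} (hε : 0 < ε) (hh : 0 < h)
    {m n : ℕ} (z : Fin m → Fin n → ℤ) (a : Fin m → ℝ) :
    0 ≤ ∑ j, ∑ k, a k * a j * g (ε + sqd (z k) (z j) * h) := by
  have := hausdorff_pos hg hε hh (Finset.univ : Finset (Fin m × Fin m))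
    (fun q => a q.2 * a q.1) (fun q => sqd (z q.2) (z q.1)) (fun y h0 h1 => by
      rw [Fintype.sum_prod_type]; exact lattice_pd z a y h0 h1)
  rwa [Fintype.sum_prod_type] at this

lemma floor_tendsto (x : ℝ) :
    Tendsto (fun N : ℕ => (⌊((N : ℝ) + 1) * x⌋ : ℝ) * (1 / ((N : ℝ) + 1))) atTop (𝓝 x) := by
  have h0 := tendsto_one_div_add_atTop_nhds_zero_nat (𝕜 := ℝ)
  have h1 : Tendsto (fun N : ℕ => x - 1 / ((N : ℝ) + 1)) atTop (𝓝 x) := by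
    simpa using h0.const_sub x
  refine tendsto_of_tendsto_of_tendsto_of_le_of_le h1 tendsto_const_nhds (fun N => ?_)
    (fun N => ?_)
  · have hN : (0 : ℝ) < (N : ℝ) + 1 := by positivity
    have := Int.sub_one_lt_floor (((N : ℝ) + 1) * x)
    have h := mul_le_mul_of_nonneg_right this.le (by positivity : 0 ≤ 1 / ((N : ℝ) + 1))
    calc x - 1 / ((N : ℝ) + 1) = (((N : ℝ) + 1) * x - 1) * (1 / ((N : ℝ) + 1)) := by field_simp
      _ ≤ _ := h
  · have hN : (0 : ℝ) < (N : ℝ) + 1 := by positivity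
    have := Int.floor_le (((N : ℝ) + 1) * x)
    have h := mul_le_mul_of_nonneg_right this (by positivity : 0 ≤ 1 / ((N : ℝ) + 1))
    calc _ ≤ (((N : ℝ) + 1) * x) * (1 / ((N : ℝ) + 1)) := h
      _ = x := by field_simp

lemma real_pd {f : ℝ → ℝ} (hcont : ContinuousOn f (Set.Ici 0)) (hf : ∀ k, CMk k f) {m n : ℕ}
    (x : Fin m → EuclideanSpace ℝ (Fin n)) (a : Fin m → ℝ) :
    0 ≤ ∑ j, ∑ k, a k * a j * f ‖x k - x j‖ := by
  have ht : Tendsto (fun N : ℕ => ∑ j, ∑ k, a k * a j * f (Real.sqrt (1 / ((N : ℝ) + 1) +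
      (sqd (fun i => ⌊((N : ℝ) + 1) * x k i⌋) (fun i => ⌊((N : ℝ) + 1) * x j i⌋) : ℝ) *
        (1 / ((N : ℝ) + 1)) ^ 2))) atTop (𝓝 (∑ j, ∑ k, a k * a j * f ‖x k - x j‖)) := by
    refine tendsto_finsetSum _ fun j _ => tendsto_finsetSum _ fun k _ => Tendsto.const_mul _ ?_
    refine (hcont ‖x k - x j‖ (norm_nonneg _)).tendsto.comp ?_
    refine tendsto_nhdsWithin_iff.2 ⟨?_, Eventually.of_forall fun N => Real.sqrt_nonneg _⟩
    rw [EuclideanSpace.norm_eq]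
    refine (Real.continuous_sqrt.tendsto _).comp ?_
    have h1 : Tendsto (fun N : ℕ => ∑ i, ((⌊((N : ℝ) + 1) * x k i⌋ : ℝ) * (1 / ((N : ℝ) + 1)) -
        (⌊((N : ℝ) + 1) * x j i⌋ : ℝ) * (1 / ((N : ℝ) + 1))) ^ 2) atTop
        (𝓝 (∑ i, (x k i - x j i) ^ 2)) :=
      tendsto_finsetSum _ fun i _ => ((floor_tendsto _).sub (floor_tendsto _)).pow 2
    have h2 := (tendsto_one_div_add_atTop_nhds_zero_nat (𝕜 := ℝ)).add h1
    rw [zero_add] at h2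
    simp only [Real.norm_eq_abs, sq_abs, PiLp.sub_apply]
    refine h2.congr fun N => ?_
    rw [sqd_cast, Finset.sum_mul]
    congr 1
    exact Finset.sum_congr rfl fun i _ => by ring
  refine ge_of_tendsto' ht fun N => ?_
  exact lattice_cm (fun k => (hf k).sqrt) (by positivity) (by positivity)
    (fun k i => ⌊((N : ℝ) + 1) * x k i⌋) a

lemma cmk_of_hyp (f : ℝ → ℝ)
    (hsmooth : ContDiffOn ℝ (⊤ : ℕ∞) f (Set.Ioi 0))
    (hmono : ∀ (k : ℕ) (t : ℝ), 0 < t →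
      0 ≤ (-1 : ℝ) ^ k * iteratedDerivWithin k f (Set.Ioi 0) t) (k : ℕ) :
    ∀ j, CMk k (fun t => (-1 : ℝ) ^ j * iteratedDerivWithin j f (Set.Ioi 0) t) := by
  induction k with
  | zero => intro j t ht; exact hmono j t ht
  | succ k ih =>
    intro j
    refine ⟨fun t ht => hmono j t ht, _, ih (j + 1), fun t ht => ?_⟩
    have hd := hsmooth.differentiableOn_iteratedDerivWithin (m := j)
      (by exact_mod_cast WithTop.coe_lt_top j) (uniqueDiffOn_Ioi 0) t ht
    have := (hd.hasDerivWithinAt.hasDerivAt (Ioi_mem_nhds ht)).const_mul ((-1 : ℝ) ^ j)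
    refine this.congr_deriv ?_
    rw [iteratedDerivWithin_succ, pow_succ]
    ring

/-- If `f ∈ C[0,∞) ∩ C^∞(0,∞)` is completely monotone
(`(−1)^k f^{(k)}(t) ≥ 0` for all `k ≥ 0`, `t > 0`), then for every `n`
the function `x ↦ f(|x|)` is positive definite on `ℝⁿ`. -/
theorem statement_2 (f : ℝ → ℝ)
    (hcont : ContinuousOn f (Set.Ici 0))
    (hsmooth : ContDiffOn ℝ (⊤ : ℕ∞) f (Set.Ioi 0))
    (hmono : ∀ (k : ℕ) (t : ℝ), 0 < t →
      0 ≤ (-1 : ℝ) ^ k * iteratedDerivWithin k f (Set.Ioi 0) t)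
    (n : ℕ) :
    IsPosDefFn (fun x : EuclideanSpace ℝ (Fin n) => (f ‖x‖ : ℂ)) := by
  have hf : ∀ k, CMk k f := fun k => by
    simpa using cmk_of_hyp f hsmooth hmono k 0
  refine ⟨?_, fun m x ξ => ?_⟩
  · have h1 : ContinuousWithinAt f (Set.Ici 0) ‖(0 : EuclideanSpace ℝ (Fin n))‖ := by
      rw [norm_zero]; exact hcont 0 Set.self_mem_Ici
    have h2 : Tendsto (fun x : EuclideanSpace ℝ (Fin n) => f ‖x‖) (𝓝 0)
        (𝓝 (f ‖(0 : EuclideanSpace ℝ (Fin n))‖)) :=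
      h1.tendsto.comp (tendsto_nhdsWithin_iff.2
        ⟨continuous_norm.tendsto _, Eventually.of_forall fun x => norm_nonneg x⟩)
    exact (Complex.continuous_ofReal.tendsto _).comp h2
  · have hre := add_nonneg (real_pd hcont hf x (fun k => (ξ k).re))
      (real_pd hcont hf x (fun k => (ξ k).im))
    rw [Complex.le_def]
    constructor
    · refine hre.trans_eq ?_
      simp only [Complex.re_sum, ← Finset.sum_add_distrib]
      refine Finset.sum_congr rfl fun j _ => Finset.sum_congr rfl fun k _ => ?_
      simp
      ring
    · have e : (∑ j, ∑ k, ξ k * (starRingEnd ℂ) (ξ j) * (f ‖x k - x j‖ : ℂ)).im =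
          ∑ j, ∑ k, (ξ k).im * (ξ j).re * f ‖x k - x j‖ -
          ∑ j, ∑ k, (ξ k).re * (ξ j).im * f ‖x k - x j‖ := by
        simp only [Complex.im_sum, ← Finset.sum_sub_distrib]
        refine Finset.sum_congr rfl fun j _ => Finset.sum_congr rfl fun k _ => ?_
        simp
        ring
      rw [e, Finset.sum_comm, Complex.zero_im, eq_comm, sub_eq_zero]
      refine Finset.sum_congr rfl fun j _ => Finset.sum_congr rfl fun k _ => ?_
      rw [norm_sub_rev]
      ring
end
end

section
/- Let τ be a finite positive Borel measure on [0,∞) with τ((0,∞)) > 0, and let f(t) = ∫_0^∞ e^{−ts} dτ(s) for t ∈ [0,∞) (so f is a nonconstant completely monotone function). Let X = {x_k}_{k≥1} be a sequence of points of ℝ³ with d_*(X) > 0. Then the function x ↦ f(|x|) on ℝ³ is strongly X-positive definite. -/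
open MeasureTheory Filter
open scoped ComplexOrder ENNReal RealInnerProductSpace

noncomputable section

abbrev E3 : Type := EuclideanSpace ℝ (Fin 3)

lemma gauss_integrable {b : ℝ} (hb : 0 < b) :
    Integrable (fun v : E3 => Real.exp (-b * ‖v‖ ^ 2)) := by
  have h := (GaussianFourier.integrable_cexp_neg_mul_sq_norm_add (V := E3) (b := (b : ℂ))
    (by simpa using hb) 0 0).re
  refine h.congr (Filter.Eventually.of_forall fun v => ?_)
  have : (-(b : ℂ) * (‖v‖ : ℂ) ^ 2 + 0 * ((inner ℝ (0 : E3) v : ℝ) : ℂ))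
      = ((-b * ‖v‖ ^ 2 : ℝ) : ℂ) := by push_cast; ring
  simp only [this]
  rw [← Complex.ofReal_exp]
  rfl

lemma gauss_pos {b : ℝ} (hb : 0 < b) :
    0 < ∫ v : E3, Real.exp (-b * ‖v‖ ^ 2) := by
  rw [GaussianFourier.integral_rexp_neg_mul_sq_norm hb]
  positivity

lemma gauss_prod (u : ℝ) (p q x : E3) :
    Real.exp (-(2 * u) * ‖x - p‖ ^ 2) * Real.exp (-(2 * u) * ‖x - q‖ ^ 2)
      = Real.exp (-(4 * u) * ‖x - (1 / 2 : ℝ) • (p + q)‖ ^ 2) * Real.exp (-(u * ‖q - p‖ ^ 2)) := by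
  rw [← Real.exp_add, ← Real.exp_add]
  congr 1
  have h := parallelogram_law_with_norm ℝ (x - p) (x - q)
  have e1 : x - p + (x - q) = (2 : ℝ) • (x - (1 / 2 : ℝ) • (p + q)) := by module
  have e2 : x - p - (x - q) = q - p := by abel
  rw [e1, e2, norm_smul] at h
  norm_num at h
  norm_num
  linear_combination u * h

lemma gauss_psd {u : ℝ} (hu : 0 < u) {m : ℕ} (y : Fin m → E3) (a : Fin m → ℝ) :
    0 ≤ ∑ j, ∑ k, a k * a j * Real.exp (-(u * ‖y k - y j‖ ^ 2)) := by
  set C := ∫ v : E3, Real.exp (-(4 * u) * ‖v‖ ^ 2) with hC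
  have hCpos : 0 < C := gauss_pos (by positivity)
  have hint : ∀ p q : E3, Integrable (fun x : E3 =>
      Real.exp (-(2 * u) * ‖x - p‖ ^ 2) * Real.exp (-(2 * u) * ‖x - q‖ ^ 2)) := by
    intro p q
    simp_rw [gauss_prod]
    exact ((gauss_integrable (b := 4 * u) (by positivity)).comp_sub_right _).mul_const _
  have hval : ∀ p q : E3, ∫ x : E3,
      Real.exp (-(2 * u) * ‖x - p‖ ^ 2) * Real.exp (-(2 * u) * ‖x - q‖ ^ 2)
        = C * Real.exp (-(u * ‖q - p‖ ^ 2)) := by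
    intro p q
    simp_rw [gauss_prod]
    rw [integral_mul_const, integral_sub_right_eq_self (fun x : E3 => Real.exp (-(4 * u) * ‖x‖ ^ 2))]
  have key : ∫ x : E3, (∑ k, a k * Real.exp (-(2 * u) * ‖x - y k‖ ^ 2)) ^ 2
      = C * ∑ j, ∑ k, a k * a j * Real.exp (-(u * ‖y k - y j‖ ^ 2)) := by
    have : ∀ x : E3, (∑ k, a k * Real.exp (-(2 * u) * ‖x - y k‖ ^ 2)) ^ 2
        = ∑ j, ∑ k, a k * a j * (Real.exp (-(2 * u) * ‖x - y j‖ ^ 2)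
          * Real.exp (-(2 * u) * ‖x - y k‖ ^ 2)) := by
      intro x
      rw [sq, Finset.sum_mul_sum]
      refine Finset.sum_congr rfl fun j _ => Finset.sum_congr rfl fun k _ => ?_
      ring
    simp_rw [this]
    rw [integral_finsetSum _ (fun j _ => integrable_finsetSum _ fun k _ => (hint _ _).const_mul _),
      Finset.mul_sum]
    refine Finset.sum_congr rfl fun j _ => ?_
    rw [integral_finsetSum _ (fun k _ => (hint _ _).const_mul _), Finset.mul_sum]
    refine Finset.sum_congr rfl fun k _ => ?_
    rw [integral_const_mul, hval]
    ring
  have h0 : 0 ≤ C * ∑ j, ∑ k, a k * a j * Real.exp (-(u * ‖y k - y j‖ ^ 2)) := by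
    rw [← key]
    exact integral_nonneg fun x => sq_nonneg _
  exact nonneg_of_mul_nonneg_right h0 hCpos

lemma sum_bound {d : ℝ} (hd : 0 < d) : ∃ M : ℝ, 0 < M ∧ ∀ (m : ℕ) (y : Fin m → E3),
    (∀ i j, i ≠ j → d ≤ dist (y i) (y j)) → ∀ j, ∑ k, Real.exp (-‖y k - y j‖ ^ 2) ≤ M := by
  set V := (volume : Measure E3).real (Metric.ball (0 : E3) (d / 2)) with hV
  have hVpos : 0 < V := by
    rw [hV, Measure.real, ENNReal.toReal_pos_iff]
    exact ⟨Metric.measure_ball_pos _ _ (by positivity), measure_ball_lt_top⟩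
  set G := ∫ v : E3, Real.exp (-(1 / 2) * ‖v‖ ^ 2) with hG
  have hGpos : 0 < G := gauss_pos (by norm_num)
  refine ⟨G / V * Real.exp (d ^ 2 / 4), by positivity, ?_⟩
  intro m y hy j
  have hgi : Integrable (fun x : E3 => Real.exp (-(1 / 2) * ‖x - y j‖ ^ 2)) :=
    (gauss_integrable (b := 1 / 2) (by norm_num)).comp_sub_right (y j)
  have hball : ∀ k, V * (Real.exp (-‖y k - y j‖ ^ 2) * Real.exp (-(d ^ 2 / 4))) ≤
      ∫ x in Metric.ball (y k) (d / 2), Real.exp (-(1 / 2) * ‖x - y j‖ ^ 2) := by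
    intro k
    have hVk : (volume : Measure E3).real (Metric.ball (y k) (d / 2)) = V := by
      rw [hV, Measure.real, Measure.real, Measure.addHaar_ball_center]
    have hc : ∫ x in Metric.ball (y k) (d / 2),
        (Real.exp (-‖y k - y j‖ ^ 2) * Real.exp (-(d ^ 2 / 4)))
        = V * (Real.exp (-‖y k - y j‖ ^ 2) * Real.exp (-(d ^ 2 / 4))) := by
      rw [setIntegral_const, hVk, smul_eq_mul]
    rw [← hc]
    refine setIntegral_mono_on (integrableOn_const measure_ball_lt_top.ne) hgi.integrableOn
      measurableSet_ball ?_
    intro x hx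
    rw [← Real.exp_add]
    apply Real.exp_le_exp.mpr
    rw [Metric.mem_ball, dist_eq_norm] at hx
    have h1 : ‖x - y j‖ ≤ ‖x - y k‖ + ‖y k - y j‖ := norm_sub_le_norm_sub_add_norm_sub _ _ _
    have h2 := norm_nonneg (x - y j)
    have h3 := norm_nonneg (x - y k)
    have h4 := norm_nonneg (y k - y j)
    have h5 : ‖x - y j‖ ^ 2 ≤ (‖x - y k‖ + ‖y k - y j‖) ^ 2 := by gcongr
    have h6 : ‖x - y k‖ ^ 2 ≤ (d / 2) ^ 2 := by gcongr
    nlinarith [sq_nonneg (‖x - y k‖ - ‖y k - y j‖)]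
  have hsum : ∑ k, ∫ x in Metric.ball (y k) (d / 2), Real.exp (-(1 / 2) * ‖x - y j‖ ^ 2) ≤ G := by
    rw [← integral_iUnion_fintype (fun k => measurableSet_ball) _ (fun k => hgi.integrableOn)]
    · refine (setIntegral_le_integral hgi (Filter.Eventually.of_forall fun x => by positivity)).trans ?_
      rw [integral_sub_right_eq_self (fun x : E3 => Real.exp (-(1 / 2) * ‖x‖ ^ 2))]
    · intro i k hik
      apply Metric.ball_disjoint_ball
      have := hy i k hik
      linarith
  have hfin : (∑ k, Real.exp (-‖y k - y j‖ ^ 2)) * (V * Real.exp (-(d ^ 2 / 4))) ≤ G := by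
    refine le_trans ?_ hsum
    rw [Finset.sum_mul]
    refine Finset.sum_le_sum fun k _ => ?_
    refine le_trans (le_of_eq ?_) (hball k)
    ring
  rw [← le_div_iff₀ (by positivity)] at hfin
  refine hfin.trans (le_of_eq ?_)
  rw [Real.exp_neg]
  field_simp

lemma diag_dom {m : ℕ} (g : Fin m → Fin m → ℝ) (hg0 : ∀ j k, 0 ≤ g j k)
    (hsymm : ∀ j k, g j k = g k j) (hdiag : ∀ j, g j j = 1)
    (hoff : ∀ j, ∑ k, (if k = j then 0 else g j k) ≤ 1 / 2) (a : Fin m → ℝ) :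
    1 / 2 * ∑ j, a j ^ 2 ≤ ∑ j, ∑ k, a k * a j * g j k := by
  set h : Fin m → Fin m → ℝ := fun j k => if k = j then 0 else g j k with hh
  have hs : ∀ j k, h j k = h k j := by
    intro j k
    simp only [hh, eq_comm (a := k), hsymm j k]
  have h0 : ∀ j k, 0 ≤ h j k := by
    intro j k
    simp only [hh]
    split_ifs
    · exact le_rfl
    · exact hg0 _ _
  have e1 : ∑ j, ∑ k, a k * a j * g j k = ∑ j, a j ^ 2 + ∑ j, ∑ k, a k * a j * h j k := by
    rw [← Finset.sum_add_distrib]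
    refine Finset.sum_congr rfl fun j _ => ?_
    have : a j ^ 2 = ∑ k, if k = j then a j ^ 2 else 0 := by simp
    rw [this, ← Finset.sum_add_distrib]
    refine Finset.sum_congr rfl fun k _ => ?_
    by_cases hkj : k = j
    · subst hkj
      simp [hh, hdiag, sq]
    · simp [hh, hkj]
  have e2 : ∑ j, ∑ k, a k ^ 2 * h j k = ∑ j, ∑ k, a j ^ 2 * h j k := by
    rw [Finset.sum_comm]
    refine Finset.sum_congr rfl fun j _ => Finset.sum_congr rfl fun k _ => ?_
    rw [hs]
  have e3 : ∑ j, ∑ k, a j ^ 2 * h j k ≤ 1 / 2 * ∑ j, a j ^ 2 := by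
    rw [Finset.mul_sum]
    refine Finset.sum_le_sum fun j _ => ?_
    rw [← Finset.mul_sum]
    nlinarith [hoff j, sq_nonneg (a j)]
  have e4 : 0 ≤ ∑ j, ∑ k, a k * a j * h j k
      + (1 / 2) * (∑ j, ∑ k, a k ^ 2 * h j k + ∑ j, ∑ k, a j ^ 2 * h j k) := by
    rw [← Finset.sum_add_distrib, Finset.mul_sum, ← Finset.sum_add_distrib]
    refine Finset.sum_nonneg fun j _ => ?_
    rw [← Finset.sum_add_distrib, Finset.mul_sum, ← Finset.sum_add_distrib]
    refine Finset.sum_nonneg fun k _ => ?_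
    have := mul_nonneg (sq_nonneg (a k + a j)) (h0 j k)
    nlinarith
  rw [e1]
  linarith

lemma gauss_strong {d : ℝ} (hd : 0 < d) : ∃ u₀ : ℝ, 0 < u₀ ∧ ∀ u, u₀ ≤ u → ∀ (m : ℕ)
    (y : Fin m → E3), (∀ i j, i ≠ j → d ≤ dist (y i) (y j)) → ∀ a : Fin m → ℝ,
    1 / 2 * ∑ j, a j ^ 2 ≤ ∑ j, ∑ k, a k * a j * Real.exp (-(u * ‖y k - y j‖ ^ 2)) := by
  obtain ⟨M, hM, hb⟩ := sum_bound hd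
  refine ⟨1 + 2 * M / d ^ 2, by positivity, ?_⟩
  intro u hu m y hy a
  have hu1 : 2 * M ≤ (u - 1) * d ^ 2 := by
    rw [← div_le_iff₀ (by positivity)]
    linarith
  have hu0 : 0 ≤ u - 1 := by
    have : 0 ≤ 2 * M / d ^ 2 := by positivity
    linarith
  have hexp : Real.exp (-((u - 1) * d ^ 2)) * M ≤ 1 / 2 := by
    have h1 : 2 * M ≤ Real.exp ((u - 1) * d ^ 2) := by
      linarith [Real.add_one_le_exp ((u - 1) * d ^ 2)]
    rw [Real.exp_neg, inv_mul_le_iff₀ (Real.exp_pos _)]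
    linarith
  refine diag_dom (fun j k => Real.exp (-(u * ‖y k - y j‖ ^ 2))) (fun j k => by positivity)
    (fun j k => by simp only [norm_sub_rev]) (fun j => by simp) (fun j => ?_) a
  refine le_trans ?_ hexp
  refine le_trans ?_ (mul_le_mul_of_nonneg_left (hb m y hy j) (Real.exp_pos _).le)
  rw [Finset.mul_sum]
  refine Finset.sum_le_sum fun k _ => ?_
  split_ifs with hkj
  · positivity
  · rw [← Real.exp_add]
    apply Real.exp_le_exp.mpr
    have h1 := hy k j hkj
    rw [dist_eq_norm] at h1
    have h2 : d ^ 2 ≤ ‖y k - y j‖ ^ 2 := by gcongr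
    nlinarith

lemma schloemilch {a b : ℝ} (ha : 0 < a) (hb : 0 < b) :
    ∫ v in Set.Ioi (0 : ℝ), Real.exp (-(a * v - b / v) ^ 2) = √Real.pi / (2 * a) := by
  have hder : ∀ v ∈ Set.Ioi (0 : ℝ),
      HasDerivWithinAt (fun v : ℝ => a * v - b / v) (a + b / v ^ 2) (Set.Ioi 0) v := by
    intro v hv
    have hv0 : v ≠ 0 := (ne_of_gt hv)
    have h := ((hasDerivAt_id v).const_mul a).sub ((hasDerivAt_inv hv0).const_mul b)
    refine (h.congr_deriv ?_).hasDerivWithinAt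
    field_simp
    ring
  have hinj : Set.InjOn (fun v : ℝ => a * v - b / v) (Set.Ioi 0) := by
    intro v hv w hw h
    have hv' : 0 < v := hv
    have hw' : 0 < w := hw
    simp only at h
    have h2 : (v - w) * (a + b / (v * w)) = 0 := by
      have : (v - w) * (a + b / (v * w)) = (a * v - b / v) - (a * w - b / w) := by
        field_simp
        ring
      rw [this, h, sub_self]
    have h3 : a + b / (v * w) ≠ 0 := by positivity
    have := (mul_eq_zero.mp h2).resolve_right h3
    linarith
  have himg : (fun v : ℝ => a * v - b / v) '' Set.Ioi 0 = Set.univ := by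
    rw [Set.eq_univ_iff_forall]
    intro w
    have hD : 0 < w ^ 2 + 4 * a * b := by positivity
    have hs := Real.sq_sqrt hD.le
    set S := √(w ^ 2 + 4 * a * b)
    have hS : 0 ≤ S := Real.sqrt_nonneg _
    have hpos : 0 < w + S := by
      have hab : 0 < a * b := by positivity
      by_contra hcon
      push Not at hcon
      nlinarith
    refine ⟨(w + S) / (2 * a), by simp only [Set.mem_Ioi]; positivity, ?_⟩
    simp only
    field_simp
    linear_combination hs
  have hgint : Integrable (fun w : ℝ => Real.exp (-w ^ 2)) := by
    simpa using integrable_exp_neg_mul_sq (b := 1) one_pos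
  have hgval : ∫ w : ℝ, Real.exp (-w ^ 2) = √Real.pi := by
    simpa using integral_gaussian 1
  have hI := integral_image_eq_integral_abs_deriv_smul measurableSet_Ioi hder hinj
    (fun w => Real.exp (-w ^ 2))
  have hInt := (integrableOn_image_iff_integrableOn_abs_deriv_smul measurableSet_Ioi hder hinj
    (fun w => Real.exp (-w ^ 2))).mp (by rw [himg]; exact hgint.integrableOn)
  rw [himg, setIntegral_univ, hgval] at hI
  have habs : ∀ v : ℝ, |a + b / v ^ 2| = a + b / v ^ 2 := fun v => abs_of_pos (by positivity)
  simp only [habs, smul_eq_mul] at hI hInt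
  have hm : ∀ c : ℝ → ℝ, Measurable c → AEStronglyMeasurable
      (fun v => c v * Real.exp (-(a * v - b / v) ^ 2)) (volume.restrict (Set.Ioi 0)) := by
    intro c hc
    apply Measurable.aestronglyMeasurable
    fun_prop
  have hA : IntegrableOn (fun v => a * Real.exp (-(a * v - b / v) ^ 2)) (Set.Ioi 0) := by
    refine Integrable.mono' hInt (hm (fun _ => a) (by fun_prop)) (Filter.Eventually.of_forall fun v => ?_)
    rw [Real.norm_of_nonneg (by positivity)]
    have : 0 ≤ b / v ^ 2 := by positivity
    gcongr
    linarith
  have hB : IntegrableOn (fun v => b / v ^ 2 * Real.exp (-(a * v - b / v) ^ 2)) (Set.Ioi 0) := by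
    refine Integrable.mono' hInt (hm (fun v => b / v ^ 2) (by fun_prop))
      (Filter.Eventually.of_forall fun v => ?_)
    rw [Real.norm_of_nonneg (by positivity)]
    gcongr
    linarith
  simp only [add_mul] at hI
  rw [integral_add hA hB] at hI
  -- the involution
  have hder2 : ∀ v ∈ Set.Ioi (0 : ℝ),
      HasDerivWithinAt (fun v : ℝ => (b / a) / v) (-(b / a) / v ^ 2) (Set.Ioi 0) v := by
    intro v hv
    have hv0 : v ≠ 0 := (ne_of_gt hv)
    have h := (hasDerivAt_inv hv0).const_mul (b / a)
    refine (h.congr_deriv ?_).hasDerivWithinAt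
    field_simp
  have hinj2 : Set.InjOn (fun v : ℝ => (b / a) / v) (Set.Ioi 0) := by
    intro v hv w hw h
    have hv' : 0 < v := hv
    have hw' : 0 < w := hw
    simp only at h
    field_simp at h
    linarith
  have himg2 : (fun v : ℝ => (b / a) / v) '' Set.Ioi 0 = Set.Ioi 0 := by
    ext w
    constructor
    · rintro ⟨v, hv, rfl⟩
      have hv' : 0 < v := hv
      simp only [Set.mem_Ioi]
      positivity
    · intro hw
      have hw' : 0 < w := hw
      refine ⟨(b / a) / w, by simp only [Set.mem_Ioi]; positivity, ?_⟩
      simp only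
      field_simp
  have hI2 := integral_image_eq_integral_abs_deriv_smul measurableSet_Ioi hder2 hinj2
    (fun v => a * Real.exp (-(a * v - b / v) ^ 2))
  rw [himg2] at hI2
  have hI3 : ∫ v in Set.Ioi (0 : ℝ), a * Real.exp (-(a * v - b / v) ^ 2)
      = ∫ v in Set.Ioi (0 : ℝ), b / v ^ 2 * Real.exp (-(a * v - b / v) ^ 2) := by
    rw [hI2]
    refine setIntegral_congr_fun measurableSet_Ioi fun v hv => ?_
    have hv' : 0 < v := hv
    have e1 : |-(b / a) / v ^ 2| = (b / a) / v ^ 2 := by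
      rw [neg_div, abs_neg, abs_of_pos (by positivity)]
    have e2 : (a * (b / a / v) - b / (b / a / v)) ^ 2 = (a * v - b / v) ^ 2 := by
      have : a * (b / a / v) - b / (b / a / v) = -(a * v - b / v) := by
        field_simp
        ring
      rw [this, neg_sq]
    simp only [smul_eq_mul]
    rw [e1, e2, ← mul_assoc]
    congr 1
    field_simp
  rw [← hI3, integral_const_mul] at hI
  rw [eq_div_iff (by positivity)]
  linarith

lemma sub_meas (s r : ℝ) : Measurable (fun v : ℝ => Real.exp (-(s ^ 2 / 4 * v ^ 2)) *
    Real.exp (-(1 / v ^ 2 * r ^ 2))) := by fun_prop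

lemma sub_integrable {s : ℝ} (hs : 0 < s) (r : ℝ) :
    IntegrableOn (fun v : ℝ => Real.exp (-(s ^ 2 / 4 * v ^ 2)) *
      Real.exp (-(1 / v ^ 2 * r ^ 2))) (Set.Ioi 0) := by
  have h : Integrable (fun v : ℝ => Real.exp (-(s ^ 2 / 4 * v ^ 2))) := by
    simpa using integrable_exp_neg_mul_sq (b := s ^ 2 / 4) (by positivity)
  refine Integrable.mono' h.integrableOn (sub_meas s r).aestronglyMeasurable
    (Filter.Eventually.of_forall fun v => ?_)
  rw [Real.norm_of_nonneg (by positivity)]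
  refine mul_le_of_le_one_right (by positivity) ?_
  apply Real.exp_le_one_iff.mpr
  have : 0 ≤ 1 / v ^ 2 * r ^ 2 := by positivity
  linarith

lemma subordination {s : ℝ} (hs : 0 < s) {r : ℝ} (hr : 0 ≤ r) :
    s / √Real.pi * ∫ v in Set.Ioi (0 : ℝ), Real.exp (-(s ^ 2 / 4 * v ^ 2)) *
      Real.exp (-(1 / v ^ 2 * r ^ 2)) = Real.exp (-(r * s)) := by
  have hpi : 0 < √Real.pi := Real.sqrt_pos.mpr Real.pi_pos
  rcases hr.eq_or_lt with rfl | hr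
  · have h := integral_gaussian_Ioi (s ^ 2 / 4)
    simp only [ne_eq, OfNat.ofNat_ne_zero, not_false_eq_true, zero_pow, mul_zero, neg_zero,
      Real.exp_zero, mul_one, zero_mul]
    simp only [neg_mul] at h
    rw [h, Real.sqrt_div Real.pi_pos.le]
    have : √(s ^ 2 / 4) = s / 2 := by
      rw [show s ^ 2 / 4 = (s / 2) ^ 2 by ring, Real.sqrt_sq (by positivity)]
    rw [this]
    field_simp
  · have h := schloemilch (a := s / 2) (b := r) (by positivity) hr
    have e : ∫ v in Set.Ioi (0 : ℝ), Real.exp (-(s ^ 2 / 4 * v ^ 2)) *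
      Real.exp (-(1 / v ^ 2 * r ^ 2)) =
        ∫ v in Set.Ioi (0 : ℝ), Real.exp (-(r * s)) * Real.exp (-(s / 2 * v - r / v) ^ 2) := by
      refine setIntegral_congr_fun measurableSet_Ioi fun v hv => ?_
      have hv' : 0 < v := hv
      rw [← Real.exp_add, ← Real.exp_add]
      congr 1
      field_simp
      ring
    rw [e, integral_const_mul, h]
    field_simp

/-- Quadratic form of `exp (-s r)` as a mixture of Gaussian quadratic forms. -/
lemma exp_form {s : ℝ} (hs : 0 < s) {m : ℕ} (y : Fin m → E3) (a : Fin m → ℝ) :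
    ∑ j, ∑ k, a k * a j * Real.exp (-(‖y k - y j‖ * s)) =
      s / √Real.pi * ∫ v in Set.Ioi (0 : ℝ), Real.exp (-(s ^ 2 / 4 * v ^ 2)) *
        ∑ j, ∑ k, a k * a j * Real.exp (-(1 / v ^ 2 * ‖y k - y j‖ ^ 2)) := by
  have hh : ∀ v : ℝ, Real.exp (-(s ^ 2 / 4 * v ^ 2)) *
        ∑ j, ∑ k, a k * a j * Real.exp (-(1 / v ^ 2 * ‖y k - y j‖ ^ 2)) =
      ∑ j, ∑ k, a k * a j * (Real.exp (-(s ^ 2 / 4 * v ^ 2)) *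
        Real.exp (-(1 / v ^ 2 * ‖y k - y j‖ ^ 2))) := by
    intro v
    rw [Finset.mul_sum]
    refine Finset.sum_congr rfl fun j _ => ?_
    rw [Finset.mul_sum]
    refine Finset.sum_congr rfl fun k _ => ?_
    ring
  simp_rw [hh]
  have hi := fun j k => (sub_integrable hs ‖y k - y j‖).const_mul (a k * a j)
  rw [integral_finsetSum _ (fun j _ => integrable_finsetSum _ fun k _ => hi j k), Finset.mul_sum]
  refine Finset.sum_congr rfl fun j _ => ?_
  rw [integral_finsetSum _ (fun k _ => hi j k), Finset.mul_sum]
  refine Finset.sum_congr rfl fun k _ => ?_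
  rw [integral_const_mul, ← subordination hs (norm_nonneg _)]
  ring

lemma form_integrable {s : ℝ} (hs : 0 < s) {m : ℕ} (y : Fin m → E3) (a : Fin m → ℝ) :
    IntegrableOn (fun v : ℝ => Real.exp (-(s ^ 2 / 4 * v ^ 2)) *
        ∑ j, ∑ k, a k * a j * Real.exp (-(1 / v ^ 2 * ‖y k - y j‖ ^ 2))) (Set.Ioi 0) := by
  have hi := fun j k => (sub_integrable hs ‖y k - y j‖).const_mul (a k * a j)
  have := integrable_finsetSum Finset.univ (fun j _ => integrable_finsetSum Finset.univ
    (fun k _ => hi j k))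
  refine this.congr (Filter.Eventually.of_forall fun v => ?_)
  simp only [Finset.mul_sum]
  refine Finset.sum_congr rfl fun j _ => Finset.sum_congr rfl fun k _ => ?_
  ring

lemma exp_form_nonneg {s : ℝ} (hs : 0 ≤ s) {m : ℕ} (y : Fin m → E3) (a : Fin m → ℝ) :
    0 ≤ ∑ j, ∑ k, a k * a j * Real.exp (-(‖y k - y j‖ * s)) := by
  rcases hs.eq_or_lt with rfl | hs
  · simp only [mul_zero, neg_zero, Real.exp_zero, mul_one, ← Finset.sum_mul, ← Finset.mul_sum]
    exact mul_self_nonneg _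
  · rw [exp_form hs]
    refine mul_nonneg (by positivity) (setIntegral_nonneg measurableSet_Ioi fun v hv => ?_)
    have hv' : 0 < v := hv
    exact mul_nonneg (Real.exp_pos _).le (gauss_psd (by positivity) y a)

lemma exp_form_strong {d : ℝ} (hd : 0 < d) {α β : ℝ} (hα : 0 < α) :
    ∃ c : ℝ, 0 < c ∧ ∀ s ∈ Set.Icc α β, ∀ (m : ℕ)
    (y : Fin m → E3), (∀ i j, i ≠ j → d ≤ dist (y i) (y j)) → ∀ a : Fin m → ℝ,
    c * ∑ j, a j ^ 2 ≤ ∑ j, ∑ k, a k * a j * Real.exp (-(‖y k - y j‖ * s)) := by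
  obtain ⟨u₀, hu₀, H⟩ := gauss_strong hd
  set v₀ : ℝ := 1 / √u₀ with hv₀
  have hsq : 0 < √u₀ := Real.sqrt_pos.mpr hu₀
  have hv₀pos : 0 < v₀ := by positivity
  have hv₀sq : v₀ ^ 2 = 1 / u₀ := by rw [hv₀, div_pow, Real.sq_sqrt hu₀.le, one_pow]
  have hpi : 0 < √Real.pi := Real.sqrt_pos.mpr Real.pi_pos
  refine ⟨α / √Real.pi * (v₀ * (Real.exp (-(β ^ 2 / 4 * v₀ ^ 2)) * (1 / 2))), by positivity, ?_⟩
  intro s hs m y hy a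
  have hs0 : 0 < s := lt_of_lt_of_le hα hs.1
  rw [exp_form hs0]
  have hN : 0 ≤ ∑ j, a j ^ 2 := Finset.sum_nonneg fun j _ => sq_nonneg _
  have hfi := form_integrable hs0 y a
  have hstep1 : v₀ * (Real.exp (-(β ^ 2 / 4 * v₀ ^ 2)) * (1 / 2)) * ∑ j, a j ^ 2 ≤
      ∫ v in Set.Ioc (0 : ℝ) v₀, Real.exp (-(s ^ 2 / 4 * v ^ 2)) *
        ∑ j, ∑ k, a k * a j * Real.exp (-(1 / v ^ 2 * ‖y k - y j‖ ^ 2)) := by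
    have hc : ∫ _v in Set.Ioc (0 : ℝ) v₀,
        (Real.exp (-(β ^ 2 / 4 * v₀ ^ 2)) * (1 / 2 * ∑ j, a j ^ 2)) =
        v₀ * (Real.exp (-(β ^ 2 / 4 * v₀ ^ 2)) * (1 / 2)) * ∑ j, a j ^ 2 := by
      rw [setIntegral_const]
      simp [Measure.real, hv₀pos.le]
      ring
    rw [← hc]
    refine setIntegral_mono_on (integrableOn_const measure_Ioc_lt_top.ne)
      (hfi.mono_set Set.Ioc_subset_Ioi_self) measurableSet_Ioc fun v hv => ?_
    have hv1 : 0 < v := hv.1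
    have hv2 : v ^ 2 ≤ v₀ ^ 2 := by
      have := hv.2
      gcongr
    have hsb : s ^ 2 ≤ β ^ 2 := by
      have := hs.2
      gcongr
    have hu : u₀ ≤ 1 / v ^ 2 := by
      rw [hv₀sq] at hv2
      rw [le_div_iff₀ (by positivity)]
      rw [le_div_iff₀ hu₀] at hv2
      linarith
    refine mul_le_mul ?_ (H _ hu m y hy a) (by positivity) (by positivity)
    apply Real.exp_le_exp.mpr
    have : s ^ 2 / 4 * v ^ 2 ≤ β ^ 2 / 4 * v₀ ^ 2 := by gcongr
    linarith
  have hstep2 := setIntegral_mono_set hfi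
    ((ae_restrict_iff' measurableSet_Ioi).mpr (Filter.Eventually.of_forall fun v (hv : 0 < v) =>
      mul_nonneg (Real.exp_pos _).le (gauss_psd (u := 1 / v ^ 2) (by positivity) y a)))
    (show Set.Ioc (0 : ℝ) v₀ ⊆ Set.Ioi 0 from Set.Ioc_subset_Ioi_self).eventuallyLE
  rw [mul_assoc]
  refine mul_le_mul ?_ (hstep1.trans hstep2) (by positivity) (by positivity)
  have := hs.1
  gcongr

lemma exists_interval (τ : Measure ℝ) (hτpos : 0 < τ (Set.Ioi 0)) :
    ∃ α β : ℝ, 0 < α ∧ 0 < τ (Set.Icc α β) := by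
  by_contra hcon
  push Not at hcon
  have hU : Set.Ioi (0 : ℝ) ⊆ ⋃ n : ℕ, Set.Icc (1 / ((n : ℝ) + 1)) ((n : ℝ) + 1) := by
    intro x hx
    have hx' : 0 < x := hx
    obtain ⟨n, hn⟩ := exists_nat_gt (max x (1 / x))
    have h1 := lt_of_le_of_lt (le_max_left _ _) hn
    have h2 := lt_of_le_of_lt (le_max_right _ _) hn
    refine Set.mem_iUnion.mpr ⟨n, ?_, by linarith⟩
    rw [div_lt_iff₀ hx'] at h2
    rw [div_le_iff₀ (by positivity)]
    nlinarith
  have : τ (⋃ n : ℕ, Set.Icc (1 / ((n : ℝ) + 1)) ((n : ℝ) + 1)) = 0 := by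
    rw [measure_iUnion_null_iff]
    intro n
    exact le_antisymm (hcon _ _ (by positivity)) (zero_le)
  exact hτpos.ne' (measure_mono_null hU this)

lemma real_form (τ : Measure ℝ) [IsFiniteMeasure τ]
    (hτneg : τ (Set.Iio 0) = 0) (hτpos : 0 < τ (Set.Ioi 0))
    (f : ℝ → ℝ) (hf : ∀ t, f t = ∫ s, Real.exp (-(t * s)) ∂τ) {d : ℝ} (hd : 0 < d) :
    ∃ c : ℝ, 0 < c ∧ ∀ (m : ℕ)
    (y : Fin m → E3), (∀ i j, i ≠ j → d ≤ dist (y i) (y j)) → ∀ a : Fin m → ℝ,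
    c * ∑ j, a j ^ 2 ≤ ∑ j, ∑ k, a k * a j * f ‖y k - y j‖ := by
  obtain ⟨α, β, hα, hI⟩ := exists_interval τ hτpos
  obtain ⟨c, hc, H⟩ := exp_form_strong (β := β) hd hα
  have hτr : 0 < τ.real (Set.Icc α β) :=
    ENNReal.toReal_pos hI.ne' (measure_ne_top _ _)
  refine ⟨τ.real (Set.Icc α β) * c, by positivity, ?_⟩
  intro m y hy a
  have hae : ∀ᵐ s ∂τ, 0 ≤ s := by
    rw [ae_iff]
    convert hτneg using 2
    ext s
    simp
  have hei : ∀ t : ℝ, 0 ≤ t → Integrable (fun s => Real.exp (-(t * s))) τ := by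
    intro t ht
    refine Integrable.mono' (integrable_const (1 : ℝ))
      (Measurable.aestronglyMeasurable (by fun_prop)) ?_
    filter_upwards [hae] with s hs
    rw [Real.norm_of_nonneg (by positivity), Real.exp_le_one_iff]
    have := mul_nonneg ht hs
    linarith
  have hi := fun j k => (hei ‖y k - y j‖ (norm_nonneg _)).const_mul (a k * a j)
  have hi2 := integrable_finsetSum Finset.univ (fun j _ => integrable_finsetSum Finset.univ
    (fun k _ => hi j k))
  have hq : ∑ j, ∑ k, a k * a j * f ‖y k - y j‖ =
      ∫ s, ∑ j, ∑ k, a k * a j * Real.exp (-(‖y k - y j‖ * s)) ∂τ := by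
    rw [integral_finsetSum _ (fun j _ => integrable_finsetSum _ fun k _ => hi j k)]
    refine Finset.sum_congr rfl fun j _ => ?_
    rw [integral_finsetSum _ (fun k _ => hi j k)]
    refine Finset.sum_congr rfl fun k _ => ?_
    rw [integral_const_mul, hf]
  rw [hq]
  have h1 : ∫ s in Set.Icc α β, ∑ j, ∑ k, a k * a j * Real.exp (-(‖y k - y j‖ * s)) ∂τ ≤
      ∫ s, ∑ j, ∑ k, a k * a j * Real.exp (-(‖y k - y j‖ * s)) ∂τ := by
    refine setIntegral_le_integral hi2 ?_
    filter_upwards [hae] with s hs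
    exact exp_form_nonneg hs y a
  refine le_trans ?_ h1
  have h2 : ∫ _s in Set.Icc α β, c * ∑ j, a j ^ 2 ∂τ = τ.real (Set.Icc α β) * c * ∑ j, a j ^ 2 := by
    rw [setIntegral_const, smul_eq_mul, mul_assoc]
  rw [← h2]
  exact setIntegral_mono_on (integrableOn_const (measure_ne_top _ _)) hi2.integrableOn
    measurableSet_Icc fun s hs => H s hs m y hy a

/-- Let `τ` be a finite positive Borel measure on `[0,∞)` with
`τ((0,∞)) > 0` and let `f(t) = ∫ e^{−ts} dτ(s)` (a nonconstant completely monotone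
function). If `X ⊂ ℝ³` satisfies `d_*(X) > 0`, then `x ↦ f(|x|)` is strongly
`X`-positive definite. -/
theorem statement_3 (τ : Measure ℝ) [IsFiniteMeasure τ]
    (hτneg : τ (Set.Iio 0) = 0) (hτpos : 0 < τ (Set.Ioi 0))
    (f : ℝ → ℝ) (hf : ∀ t, f t = ∫ s, Real.exp (-(t * s)) ∂τ)
    (X : ℕ → EuclideanSpace ℝ (Fin 3)) (hX : SeparatedSeq X) :
    IsStronglyPosDef X (fun x => (f ‖x‖ : ℂ)) := by
  obtain ⟨d, hd, hsep⟩ := hX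
  obtain ⟨c, hc, H⟩ := real_form τ hτneg hτpos f hf hd
  refine ⟨c, hc, ?_⟩
  intro m y hy hinj ξ
  have hy' : ∀ i j, i ≠ j → d ≤ dist (y i) (y j) := by
    intro i j hij
    obtain ⟨p, hp⟩ := hy i
    obtain ⟨q, hq⟩ := hy j
    rw [← hp, ← hq]
    apply hsep
    rintro rfl
    exact hij (hinj (hp.symm.trans hq))
  have h1 := H m y hy' (fun k => (ξ k).re)
  have h2 := H m y hy' (fun k => (ξ k).im)
  rw [Complex.le_def]
  constructor
  · have hn : ∀ k, ‖ξ k‖ ^ 2 = (ξ k).re ^ 2 + (ξ k).im ^ 2 := by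
      intro k
      rw [Complex.sq_norm, Complex.normSq_apply]
      ring
    have e : (∑ j, ∑ k, ξ k * (starRingEnd ℂ) (ξ j) * ((f ‖y k - y j‖ : ℝ) : ℂ)).re
        = ∑ j, ∑ k, (ξ k).re * (ξ j).re * f ‖y k - y j‖
          + ∑ j, ∑ k, (ξ k).im * (ξ j).im * f ‖y k - y j‖ := by
      rw [Complex.re_sum, ← Finset.sum_add_distrib]
      refine Finset.sum_congr rfl fun j _ => ?_
      rw [Complex.re_sum, ← Finset.sum_add_distrib]
      refine Finset.sum_congr rfl fun k _ => ?_
      simp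
      ring
    rw [e, Complex.ofReal_re]
    simp only [hn, Finset.sum_add_distrib, mul_add]
    linarith
  · rw [Complex.ofReal_im]
    have e : (∑ j, ∑ k, ξ k * (starRingEnd ℂ) (ξ j) * ((f ‖y k - y j‖ : ℝ) : ℂ)).im
        = ∑ j, ∑ k, (ξ k).im * (ξ j).re * f ‖y k - y j‖
          - ∑ j, ∑ k, (ξ k).re * (ξ j).im * f ‖y k - y j‖ := by
      rw [Complex.im_sum, ← Finset.sum_sub_distrib]
      refine Finset.sum_congr rfl fun j _ => ?_
      rw [Complex.im_sum, ← Finset.sum_sub_distrib]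
      refine Finset.sum_congr rfl fun k _ => ?_
      simp
      ring
    rw [e, eq_comm, sub_eq_zero, Finset.sum_comm]
    refine Finset.sum_congr rfl fun j _ => Finset.sum_congr rfl fun k _ => ?_
    rw [norm_sub_rev]
    ring
end
end

section
/- Let τ be a finite positive Borel measure on [0,∞) with τ((0,∞)) > 0 and ∫_0^∞ (s + s^{−3}) dτ(s) < ∞, and let f(t) = ∫_0^∞ e^{−ts} dτ(s). Let X = {x_k}_{k≥1} be a sequence of points of ℝ³ with d_*(X) > 0. Then the Gram matrix Gr_X(f) = (f(|x_k − x_j|))_{k,j∈ℕ} defines a bounded self-adjoint operator on ℓ²(ℕ) which has a bounded inverse; equivalently, there exist constants 0 < c ≤ C such that c·Σ_{k=1}^m |ξ_k|² ≤ Σ_{j,k=1}^m f(|x_k − x_j|) ξ_k conj(ξ_j) ≤ C·Σ_{k=1}^m |ξ_k|² for all m ∈ ℕ and all (ξ_1,…,ξ_m) ∈ ℂ^m. -/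
open MeasureTheory Filter
open scoped ComplexOrder ENNReal RealInnerProductSpace

noncomputable section

lemma aux_subord_pos {b : ℝ} (hb : 0 < b) :
    ∫ u in Set.Ioi (0:ℝ), Real.exp (-u ^ 2) * Real.exp (-(b / u) ^ 2)
      = √Real.pi / 2 * Real.exp (-(2 * b)) := by
  set G : ℝ → ℝ := fun u => Real.exp (-(u - b / u) ^ 2) with hG
  -- first change of variables
  have hd1 : ∀ x ∈ Set.Ioi (0:ℝ),
      HasDerivWithinAt (fun u => u - b / u) (1 + b / x ^ 2) (Set.Ioi 0) x := by
    intro x hx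
    have hx' : x ≠ 0 := ne_of_gt hx
    exact (HasDerivAt.congr_deriv (f := fun u => u - b / u) ((hasDerivAt_id' x).sub
      ((hasDerivAt_const x b).div (hasDerivAt_id' x) hx')) (by ring)).hasDerivWithinAt
  have hmono : StrictMonoOn (fun u : ℝ => u - b / u) (Set.Ioi 0) := by
    intro x hx y hy hxy
    have : b / y < b / x := div_lt_div_of_pos_left hb hx hxy
    simp only
    linarith
  have hinj1 := hmono.injOn
  have himg1 : (fun u : ℝ => u - b / u) '' Set.Ioi 0 = Set.univ := by
    ext y
    simp only [Set.mem_image, Set.mem_Ioi, Set.mem_univ, iff_true]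
    have h1 : 0 ≤ y ^ 2 + 4 * b := by positivity
    have h2 := Real.sq_sqrt h1
    have h3 : |y| < √(y ^ 2 + 4 * b) := by
      rw [← Real.sqrt_sq_eq_abs]; exact Real.sqrt_lt_sqrt (by positivity) (by linarith)
    have h4 : 0 < (y + √(y ^ 2 + 4 * b)) / 2 := by
      have := neg_abs_le y; linarith
    refine ⟨_, h4, ?_⟩
    have h5 : b / ((y + √(y ^ 2 + 4 * b)) / 2) = (√(y ^ 2 + 4 * b) - y) / 2 := by
      rw [div_eq_iff h4.ne']
      linarith
    rw [h5]
    ring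
  have e1 := integral_image_eq_integral_abs_deriv_smul measurableSet_Ioi hd1 hinj1
    (fun y => Real.exp (-y ^ 2))
  have i1 := integrableOn_image_iff_integrableOn_abs_deriv_smul measurableSet_Ioi hd1 hinj1
    (fun y => Real.exp (-y ^ 2))
  rw [himg1] at e1 i1
  have hgi : Integrable (fun y : ℝ => Real.exp (-y ^ 2)) := by
    simpa using integrable_exp_neg_mul_sq (b := 1) one_pos
  have hgv : ∫ y : ℝ, Real.exp (-y ^ 2) = √Real.pi := by
    simpa using integral_gaussian 1
  rw [integrableOn_univ] at i1
  have i1 := i1.1 hgi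
  rw [Measure.restrict_univ, hgv] at e1
  -- second change of variables
  have hd2 : ∀ x ∈ Set.Ioi (0:ℝ),
      HasDerivWithinAt (fun u => b / u) (-(b / x ^ 2)) (Set.Ioi 0) x := by
    intro x hx
    have hx' : x ≠ 0 := ne_of_gt hx
    exact (HasDerivAt.congr_deriv (f := fun u => b / u)
      ((hasDerivAt_const x b).div (hasDerivAt_id' x) hx') (by ring)).hasDerivWithinAt
  have hinj2 : Set.InjOn (fun u : ℝ => b / u) (Set.Ioi 0) := by
    intro x hx y hy hxy
    have hx' : x ≠ 0 := ne_of_gt hx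
    have hy' : y ≠ 0 := ne_of_gt hy
    simp only at hxy
    field_simp at hxy
    exact hxy.symm
  have himg2 : (fun u : ℝ => b / u) '' Set.Ioi 0 = Set.Ioi 0 := by
    ext y
    simp only [Set.mem_image, Set.mem_Ioi]
    constructor
    · rintro ⟨x, hx, rfl⟩; positivity
    · intro hy; exact ⟨b / y, by positivity, by field_simp⟩
  have e2 := integral_image_eq_integral_abs_deriv_smul measurableSet_Ioi hd2 hinj2 G
  rw [himg2] at e2
  have hGi : IntegrableOn G (Set.Ioi 0) := by
    refine Integrable.mono' i1 (by simp only [hG]; fun_prop) ?_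
    filter_upwards [ae_restrict_mem measurableSet_Ioi] with x hx
    have hx : 0 < x := hx
    rw [Real.norm_of_nonneg (Real.exp_nonneg _), smul_eq_mul]
    have : 1 ≤ |1 + b / x ^ 2| := by
      rw [abs_of_pos (by positivity)]; have : 0 < b / x ^ 2 := by positivity
      linarith
    exact le_mul_of_one_le_left (Real.exp_nonneg _) this
  have e3 : √Real.pi = 2 * ∫ u in Set.Ioi (0:ℝ), G u := by
    have hsplit : ∫ x in Set.Ioi (0:ℝ), |1 + b / x ^ 2| • Real.exp (-(x - b / x) ^ 2)
        = ∫ x in Set.Ioi (0:ℝ), (G x + |-(b / x ^ 2)| • G (b / x)) := by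
      refine setIntegral_congr_fun measurableSet_Ioi fun x hx => ?_
      have hx : 0 < x := hx
      have : b / x - b / (b / x) = - (x - b / x) := by field_simp; ring
      simp only [hG, smul_eq_mul, this, abs_neg]
      rw [abs_of_pos (by positivity : 0 < 1 + b / x ^ 2), abs_of_pos (by positivity : 0 < b / x ^ 2),
        neg_sq]
      ring
    have i2 := (integrableOn_image_iff_integrableOn_abs_deriv_smul measurableSet_Ioi hd2 hinj2 G).1
      (by rw [himg2]; exact hGi)
    rw [e1, hsplit, integral_add hGi i2, ← e2]
    ring
  have e4 : ∫ u in Set.Ioi (0:ℝ), Real.exp (-u ^ 2) * Real.exp (-(b / u) ^ 2)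
      = ∫ u in Set.Ioi (0:ℝ), Real.exp (-(2 * b)) * G u := by
    refine setIntegral_congr_fun measurableSet_Ioi fun x hx => ?_
    have hx : x ≠ 0 := ne_of_gt hx
    simp only [hG, ← Real.exp_add]
    congr 1
    field_simp
    ring
  rw [e4, integral_const_mul, e3]
  ring

lemma aux_subord {b : ℝ} (hb : 0 ≤ b) :
    ∫ u in Set.Ioi (0:ℝ), Real.exp (-u ^ 2) * Real.exp (-(b / u) ^ 2)
      = √Real.pi / 2 * Real.exp (-(2 * b)) := by
  rcases hb.eq_or_lt with rfl | hb
  · simpa using integral_gaussian_Ioi 1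
  · exact aux_subord_pos hb

lemma aux_exp_integrable : Integrable (fun z : EuclideanSpace ℝ (Fin 3) => Real.exp (-‖z‖)) := by
  have h := integrable_one_add_norm (E := EuclideanSpace ℝ (Fin 3)) (μ := volume) (r := 4)
    (by simp; norm_num)
  refine Integrable.mono' (h.const_mul 256) (by fun_prop) ?_
  filter_upwards with z
  rw [Real.norm_of_nonneg (Real.exp_nonneg _)]
  set t := ‖z‖ with ht
  have ht0 : 0 ≤ t := norm_nonneg _
  have h1 : (1 + t) / 4 ≤ Real.exp (t / 4) := by
    have := Real.add_one_le_exp (t / 4); linarith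
  have h2 : ((1 + t) / 4) ^ 4 ≤ Real.exp t := by
    calc _ ≤ (Real.exp (t / 4)) ^ 4 := by gcongr
      _ = Real.exp t := by rw [← Real.exp_nat_mul]; congr 1; push_cast; ring
  have h3 : (1 + t) ^ (-4 : ℝ) = ((1 + t) ^ 4)⁻¹ := by
    rw [Real.rpow_neg (by positivity)]; norm_cast
  rw [h3, Real.exp_neg, ← div_eq_mul_inv, inv_eq_one_div, div_le_div_iff₀ (Real.exp_pos _) (by positivity)]
  nlinarith [h2]

lemma aux_packing (X : ℕ → EuclideanSpace ℝ (Fin 3)) {d : ℝ} (hd : 0 < d)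
    (hX : ∀ k j, k ≠ j → d ≤ dist (X k) (X j)) :
    ∃ M : ℝ, 0 < M ∧ ∀ s : ℝ, 0 < s → ∀ (k : ℕ) (S : Finset ℕ),
      ∑ j ∈ S, Real.exp (-(dist (X k) (X j) * s)) ≤ M * (1 + (s⁻¹) ^ 3) := by
  set I := ∫ z : EuclideanSpace ℝ (Fin 3), Real.exp (-‖z‖) with hI
  have hI0 : 0 ≤ I := integral_nonneg fun _ => Real.exp_nonneg _
  set V := volume.real (Metric.ball (0 : EuclideanSpace ℝ (Fin 3)) (d / 2)) with hV
  have hV0 : 0 < V := by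
    rw [hV, Measure.real, ENNReal.toReal_pos_iff]
    exact ⟨Metric.measure_ball_pos _ _ (by positivity), measure_ball_lt_top⟩
  have key : ∀ s : ℝ, 0 < s → ∀ (k : ℕ) (S : Finset ℕ),
      V * ∑ j ∈ S, Real.exp (-(dist (X k) (X j) * s)) ≤ Real.exp (s * d / 2) * (s⁻¹ ^ 3 * I) := by
    intro s hs k S
    have hIntg : Integrable (fun z : EuclideanSpace ℝ (Fin 3) => Real.exp (-‖s • (z - X k)‖)) := by
      exact ((integrable_comp_smul_iff volume _ hs.ne').2 aux_exp_integrable).comp_sub_right (X k)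
    have hval : ∫ z : EuclideanSpace ℝ (Fin 3), Real.exp (-‖s • (z - X k)‖) = s⁻¹ ^ 3 * I := by
      rw [integral_sub_right_eq_self (fun z : EuclideanSpace ℝ (Fin 3) => Real.exp (-‖s • z‖)) (X k),
        Measure.integral_comp_smul volume (fun z : EuclideanSpace ℝ (Fin 3) => Real.exp (-‖z‖)) s]
      simp [abs_of_pos hs, hI]
    have hdisj : Set.Pairwise (S : Set ℕ) (Function.onFun Disjoint fun j => Metric.ball (X j) (d / 2)) := by
      intro i _ j _ hij
      apply Metric.ball_disjoint_ball
      linarith [hX i j hij]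
    calc V * ∑ j ∈ S, Real.exp (-(dist (X k) (X j) * s))
        = ∑ j ∈ S, ∫ z in Metric.ball (X j) (d / 2), Real.exp (-(dist (X k) (X j) * s)) := by
          rw [Finset.mul_sum]
          refine Finset.sum_congr rfl fun j _ => ?_
          rw [setIntegral_const, smul_eq_mul, hV, Measure.real, Measure.real,
            Measure.addHaar_ball_center volume (X j)]
      _ ≤ ∑ j ∈ S, ∫ z in Metric.ball (X j) (d / 2),
            Real.exp (s * d / 2) * Real.exp (-‖s • (z - X k)‖) := by
          refine Finset.sum_le_sum fun j _ => ?_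
          refine setIntegral_mono_on (integrableOn_const measure_ball_lt_top.ne)
            (hIntg.const_mul _).integrableOn measurableSet_ball fun z hz => ?_
          rw [← Real.exp_add]
          apply Real.exp_le_exp.2
          rw [norm_smul, Real.norm_of_nonneg hs.le, ← dist_eq_norm]
          have h1 : dist z (X j) < d / 2 := hz
          have h2 : dist z (X k) ≤ dist z (X j) + dist (X k) (X j) := by
            rw [dist_comm (X k)]; exact dist_triangle _ _ _
          nlinarith
      _ = ∫ z in ⋃ j ∈ S, Metric.ball (X j) (d / 2),
            Real.exp (s * d / 2) * Real.exp (-‖s • (z - X k)‖) := by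
          rw [integral_biUnion_finset S (fun _ _ => measurableSet_ball) hdisj
            (fun _ _ => (hIntg.const_mul _).integrableOn)]
      _ ≤ ∫ z, Real.exp (s * d / 2) * Real.exp (-‖s • (z - X k)‖) :=
          setIntegral_le_integral (hIntg.const_mul _) (by filter_upwards with z; positivity)
      _ = _ := by rw [integral_const_mul, hval]
  refine ⟨Real.exp (d / 2) * I / V + 1, by positivity, fun s hs k S => ?_⟩
  have hsum : ∑ j ∈ S, Real.exp (-(dist (X k) (X j) * s)) ≤ (Real.exp (d / 2) * I / V) * (1 + (s⁻¹) ^ 3) := by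
    rw [div_mul_eq_mul_div, le_div_iff₀ hV0, mul_comm]
    rcases le_total s 1 with h | h
    · refine (key s hs k S).trans ?_
      have h1 : Real.exp (s * d / 2) ≤ Real.exp (d / 2) := Real.exp_le_exp.2 (by nlinarith)
      have h2 : 0 ≤ s⁻¹ ^ 3 := by positivity
      calc _ ≤ Real.exp (d / 2) * (s⁻¹ ^ 3 * I) := by gcongr
        _ ≤ _ := by
          have : 0 ≤ Real.exp (d / 2) * I := by positivity
          nlinarith
    · calc _ ≤ V * ∑ j ∈ S, Real.exp (-(dist (X k) (X j) * 1)) := by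
            gcongr
        _ ≤ Real.exp (1 * d / 2) * (1⁻¹ ^ 3 * I) := key 1 one_pos k S
        _ = Real.exp (d / 2) * I := by simp
        _ ≤ _ := by
          have : 0 ≤ Real.exp (d / 2) * I := by positivity
          have h2 : 0 ≤ s⁻¹ ^ 3 := by positivity
          nlinarith
  refine hsum.trans ?_
  gcongr
  linarith

lemma aux_schur {m : ℕ} (G : Fin m → Fin m → ℝ) (hsym : ∀ k j, G k j = G j k) (M : ℝ)
    (hM : ∀ k, ∑ j, |G k j| ≤ M) (c : Fin m → ℝ) :
    |∑ j, ∑ k, c k * c j * G k j| ≤ M * ∑ k, c k ^ 2 := by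
  have h1 : ∀ j k, |c k * c j * G k j| ≤ (c k ^ 2 * |G k j| + c j ^ 2 * |G j k|) / 2 := by
    intro j k
    rw [abs_mul, hsym j k]
    have : |c k * c j| ≤ (c k ^ 2 + c j ^ 2) / 2 := by
      rw [abs_le]; constructor <;> nlinarith [sq_nonneg (c k - c j), sq_nonneg (c k + c j)]
    nlinarith [abs_nonneg (G k j)]
  have h2 : ∑ k, ∑ j, c k ^ 2 * |G k j| ≤ M * ∑ k, c k ^ 2 := by
    rw [Finset.mul_sum]
    refine Finset.sum_le_sum fun k _ => ?_
    rw [← Finset.mul_sum, mul_comm]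
    exact mul_le_mul_of_nonneg_right (hM k) (sq_nonneg _)
  calc |∑ j, ∑ k, c k * c j * G k j| ≤ ∑ j, ∑ k, |c k * c j * G k j| :=
        (Finset.abs_sum_le_sum_abs _ _).trans
          (Finset.sum_le_sum fun j _ => Finset.abs_sum_le_sum_abs _ _)
    _ ≤ ∑ j, ∑ k, (c k ^ 2 * |G k j| + c j ^ 2 * |G j k|) / 2 :=
        Finset.sum_le_sum fun j _ => Finset.sum_le_sum fun k _ => h1 j k
    _ = (∑ j, ∑ k, c k ^ 2 * |G k j| + ∑ j, ∑ k, c j ^ 2 * |G j k|) / 2 := by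
        simp only [← Finset.sum_div, Finset.sum_add_distrib]
    _ ≤ _ := by
        rw [Finset.sum_comm]; linarith

lemma aux_gauss_psd {a : ℝ} (ha : 0 < a) {m : ℕ} (x : Fin m → EuclideanSpace ℝ (Fin 3))
    (c : Fin m → ℝ) :
    0 ≤ ∑ j, ∑ k, c k * c j * Real.exp (-(a * dist (x k) (x j) ^ 2)) := by
  set C := ∫ z : EuclideanSpace ℝ (Fin 3), Real.exp (-(4 * a) * ‖z‖ ^ 2) with hC
  have hC0 : 0 < C := by
    rw [hC, GaussianFourier.integral_rexp_neg_mul_sq_norm (by positivity)]; positivity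
  have hIntg : Integrable fun z : EuclideanSpace ℝ (Fin 3) => Real.exp (-(4 * a) * ‖z‖ ^ 2) :=
    Integrable.of_integral_ne_zero hC0.ne'
  have hid : ∀ (y w z : EuclideanSpace ℝ (Fin 3)),
      Real.exp (-(2 * a) * ‖z - y‖ ^ 2) * Real.exp (-(2 * a) * ‖z - w‖ ^ 2)
      = Real.exp (-(a * dist y w ^ 2)) *
        Real.exp (-(4 * a) * ‖z - (1 / 2 : ℝ) • (y + w)‖ ^ 2) := by
    intro y w z
    rw [← Real.exp_add, ← Real.exp_add]
    congr 1
    have hp := parallelogram_law_with_norm ℝ (z - y) (z - w)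
    have h1 : z - y + (z - w) = (2 : ℝ) • (z - (1 / 2 : ℝ) • (y + w)) := by module
    have h2 : z - y - (z - w) = w - y := by abel
    rw [h1, h2, norm_smul, Real.norm_of_nonneg (by norm_num : (0:ℝ) ≤ 2)] at hp
    rw [dist_comm, dist_eq_norm]
    linear_combination a * hp
  have hI : ∀ y w : EuclideanSpace ℝ (Fin 3), Integrable fun z : EuclideanSpace ℝ (Fin 3) =>
      Real.exp (-(2 * a) * ‖z - y‖ ^ 2) * Real.exp (-(2 * a) * ‖z - w‖ ^ 2) := by
    intro y w
    simp only [hid]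
    exact (hIntg.comp_sub_right _).const_mul _
  have hV : ∀ y w : EuclideanSpace ℝ (Fin 3), ∫ z : EuclideanSpace ℝ (Fin 3),
      Real.exp (-(2 * a) * ‖z - y‖ ^ 2) * Real.exp (-(2 * a) * ‖z - w‖ ^ 2)
      = Real.exp (-(a * dist y w ^ 2)) * C := by
    intro y w
    simp only [hid]
    rw [integral_const_mul, integral_sub_right_eq_self
      (fun z : EuclideanSpace ℝ (Fin 3) => Real.exp (-(4 * a) * ‖z‖ ^ 2))]
  have hsq : 0 ≤ ∫ z : EuclideanSpace ℝ (Fin 3),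
      (∑ k, c k * Real.exp (-(2 * a) * ‖z - x k‖ ^ 2)) ^ 2 :=
    integral_nonneg fun _ => sq_nonneg _
  have heq : ∫ z : EuclideanSpace ℝ (Fin 3),
      (∑ k, c k * Real.exp (-(2 * a) * ‖z - x k‖ ^ 2)) ^ 2
      = (∑ j, ∑ k, c k * c j * Real.exp (-(a * dist (x k) (x j) ^ 2))) * C := by
    have : ∀ z : EuclideanSpace ℝ (Fin 3), (∑ k, c k * Real.exp (-(2 * a) * ‖z - x k‖ ^ 2)) ^ 2
        = ∑ j, ∑ k, c k * c j * (Real.exp (-(2 * a) * ‖z - x k‖ ^ 2) *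
          Real.exp (-(2 * a) * ‖z - x j‖ ^ 2)) := by
      intro z
      rw [sq, Finset.sum_mul_sum, Finset.sum_comm]
      refine Finset.sum_congr rfl fun j _ => Finset.sum_congr rfl fun k _ => by ring
    simp only [this]
    rw [integral_finsetSum _ fun j _ => integrable_finsetSum _ fun k _ => (hI _ _).const_mul _,
      Finset.sum_mul]
    refine Finset.sum_congr rfl fun j _ => ?_
    rw [integral_finsetSum _ fun k _ => (hI _ _).const_mul _, Finset.sum_mul]
    refine Finset.sum_congr rfl fun k _ => ?_
    rw [integral_const_mul, hV]
    ring
  rw [heq] at hsq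
  exact nonneg_of_mul_nonneg_left hsq hC0

lemma aux_gauss_lower (X : ℕ → EuclideanSpace ℝ (Fin 3)) {d : ℝ} (hd : 0 < d)
    (hX : ∀ k j, k ≠ j → d ≤ dist (X k) (X j)) :
    ∃ a₀ : ℝ, 0 < a₀ ∧ ∀ a, a₀ ≤ a → ∀ (m : ℕ) (c : Fin m → ℝ),
      1 / 2 * ∑ k, c k ^ 2 ≤ ∑ j, ∑ k, c k * c j *
        Real.exp (-(a * dist (X (k : ℕ)) (X (j : ℕ)) ^ 2)) := by
  obtain ⟨M, hM, hpack⟩ := aux_packing X hd hX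
  refine ⟨2 / d + 8 * M / d ^ 2, by positivity, fun a ha m c => ?_⟩
  have ha1 : 2 / d ≤ a := le_trans (by have : 0 < 8 * M / d ^ 2 := by positivity
                                       linarith) ha
  have ha2 : 8 * M / d ^ 2 ≤ a := le_trans (by have : 0 < 2 / d := by positivity
                                               linarith) ha
  have ha0 : 0 < a := lt_of_lt_of_le (by positivity) ha1
  rw [div_le_iff₀ hd] at ha1
  rw [div_le_iff₀ (by positivity)] at ha2
  set G : Fin m → Fin m → ℝ := fun k j =>
    if k = j then 0 else Real.exp (-(a * dist (X (k : ℕ)) (X (j : ℕ)) ^ 2)) with hG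
  have hrow : ∀ k, ∑ j, |G k j| ≤ 1 / 2 := by
    intro k
    have hterm : ∀ j, |G k j| ≤ Real.exp (-(a * d ^ 2 / 2)) *
        Real.exp (-(dist (X (k : ℕ)) (X (j : ℕ)) * (a * d / 2))) := by
      intro j
      by_cases hkj : k = j
      · simp only [hG, hkj, if_true, abs_zero]; positivity
      · have hd' := hX k j (fun h => hkj (Fin.ext h))
        simp only [hG, hkj, if_false]
        rw [abs_of_pos (Real.exp_pos _), ← Real.exp_add]
        apply Real.exp_le_exp.2
        set r := dist (X (k : ℕ)) (X (j : ℕ))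
        have h1 : d * r ≤ r ^ 2 := by nlinarith
        have h2 : d * d ≤ d * r := by nlinarith
        have h3 := mul_le_mul_of_nonneg_left h1 ha0.le
        have h4 := mul_le_mul_of_nonneg_left h2 ha0.le
        nlinarith
    have hs : ∑ j : Fin m, Real.exp (-(dist (X (k : ℕ)) (X (j : ℕ)) * (a * d / 2))) ≤ M * 2 := by
      have h1 := hpack (a * d / 2) (by positivity) k (Finset.range m)
      rw [Finset.sum_range] at h1
      refine h1.trans ?_
      have h2 : (a * d / 2)⁻¹ ≤ 1 := inv_le_one_of_one_le₀ (by linarith)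
      have h3 : (a * d / 2)⁻¹ ^ 3 ≤ 1 := pow_le_one₀ (by positivity) h2
      nlinarith
    have he : Real.exp (-(a * d ^ 2 / 2)) * (M * 2) ≤ 1 / 2 := by
      rw [Real.exp_neg, inv_mul_le_iff₀ (Real.exp_pos _)]
      have := Real.add_one_le_exp (a * d ^ 2 / 2)
      linarith
    calc ∑ j, |G k j| ≤ ∑ j : Fin m, Real.exp (-(a * d ^ 2 / 2)) *
        Real.exp (-(dist (X (k : ℕ)) (X (j : ℕ)) * (a * d / 2))) :=
          Finset.sum_le_sum fun j _ => hterm j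
      _ ≤ Real.exp (-(a * d ^ 2 / 2)) * (M * 2) := by
          rw [← Finset.mul_sum]; gcongr
      _ ≤ _ := he
  have hsch := aux_schur G (fun k j => by simp only [hG, eq_comm, dist_comm]) (1 / 2) hrow c
  have hdec : ∑ j, ∑ k, c k * c j * Real.exp (-(a * dist (X (k : ℕ)) (X (j : ℕ)) ^ 2))
      = ∑ k, c k ^ 2 + ∑ j, ∑ k, c k * c j * G k j := by
    rw [← Finset.sum_add_distrib]
    refine Finset.sum_congr rfl fun j _ => ?_
    have : c j ^ 2 = ∑ k, if k = j then c j ^ 2 else 0 := by simp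
    rw [this, ← Finset.sum_add_distrib]
    refine Finset.sum_congr rfl fun k _ => ?_
    by_cases h : k = j
    · subst h; simp [hG, sq]
    · simp [hG, h]
  rw [hdec]
  have := (abs_le.1 hsch).1
  linarith

lemma aux_exp_repr {s : ℝ} (hs : 0 < s) {m : ℕ} (x : Fin m → EuclideanSpace ℝ (Fin 3))
    (c : Fin m → ℝ) :
    IntegrableOn (fun u : ℝ => Real.exp (-u ^ 2) * ∑ j, ∑ k, c k * c j *
      Real.exp (-((s / (2 * u)) ^ 2 * dist (x k) (x j) ^ 2))) (Set.Ioi 0) ∧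
    ∑ j, ∑ k, c k * c j * Real.exp (-(dist (x k) (x j) * s)) =
      2 / √Real.pi * ∫ u in Set.Ioi (0:ℝ), Real.exp (-u ^ 2) * ∑ j, ∑ k, c k * c j *
        Real.exp (-((s / (2 * u)) ^ 2 * dist (x k) (x j) ^ 2)) := by
  have hpi : 0 < √Real.pi := Real.sqrt_pos.2 Real.pi_pos
  have hrw : ∀ r u : ℝ, Real.exp (-((s / (2 * u)) ^ 2 * r ^ 2))
      = Real.exp (-(r * s / 2 / u) ^ 2) := by
    intro r u
    congr 1
    rw [← mul_pow]
    congr 2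
    rw [div_mul_eq_mul_div, div_div, mul_comm s r]
  have hval : ∀ r : ℝ, 0 ≤ r → ∫ u in Set.Ioi (0:ℝ), Real.exp (-u ^ 2) *
      Real.exp (-((s / (2 * u)) ^ 2 * r ^ 2)) = √Real.pi / 2 * Real.exp (-(r * s)) := by
    intro r hr
    simp only [hrw]
    rw [aux_subord (by positivity)]
    congr 3
    ring
  have hIntg : ∀ r : ℝ, 0 ≤ r → IntegrableOn (fun u => Real.exp (-u ^ 2) *
      Real.exp (-((s / (2 * u)) ^ 2 * r ^ 2))) (Set.Ioi 0) := by
    intro r hr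
    apply Integrable.of_integral_ne_zero
    rw [hval r hr]
    positivity
  have hexp : (fun u : ℝ => Real.exp (-u ^ 2) * ∑ j, ∑ k, c k * c j *
      Real.exp (-((s / (2 * u)) ^ 2 * dist (x k) (x j) ^ 2))) = fun u =>
      ∑ j, ∑ k, c k * c j * (Real.exp (-u ^ 2) *
        Real.exp (-((s / (2 * u)) ^ 2 * dist (x k) (x j) ^ 2))) := by
    funext u
    simp only [Finset.mul_sum]
    refine Finset.sum_congr rfl fun j _ => Finset.sum_congr rfl fun k _ => by ring
  rw [hexp]
  refine ⟨integrable_finsetSum _ fun j _ => integrable_finsetSum _ fun k _ =>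
    (hIntg _ dist_nonneg).const_mul _, ?_⟩
  rw [integral_finsetSum _ fun j _ => integrable_finsetSum _ fun k _ =>
    (hIntg _ dist_nonneg).const_mul _, Finset.mul_sum]
  refine Finset.sum_congr rfl fun j _ => ?_
  rw [integral_finsetSum _ fun k _ => (hIntg _ dist_nonneg).const_mul _, Finset.mul_sum]
  refine Finset.sum_congr rfl fun k _ => ?_
  rw [integral_const_mul, hval _ dist_nonneg]
  field_simp

lemma aux_exp_psd {s : ℝ} (hs : 0 < s) {m : ℕ} (x : Fin m → EuclideanSpace ℝ (Fin 3))
    (c : Fin m → ℝ) :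
    0 ≤ ∑ j, ∑ k, c k * c j * Real.exp (-(dist (x k) (x j) * s)) := by
  rw [(aux_exp_repr hs x c).2]
  refine mul_nonneg (by positivity) (setIntegral_nonneg measurableSet_Ioi fun u hu => ?_)
  have hu : 0 < u := hu
  exact mul_nonneg (Real.exp_nonneg _) (aux_gauss_psd (by positivity) x c)

lemma aux_exp_lower (X : ℕ → EuclideanSpace ℝ (Fin 3)) {d : ℝ} (hd : 0 < d)
    (hX : ∀ k j, k ≠ j → d ≤ dist (X k) (X j)) {s₀ : ℝ} (hs₀ : 0 < s₀) :
    ∃ c₀ : ℝ, 0 < c₀ ∧ ∀ s, s₀ ≤ s → ∀ (m : ℕ) (c : Fin m → ℝ),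
      c₀ * ∑ k, c k ^ 2 ≤ ∑ j, ∑ k, c k * c j *
        Real.exp (-(dist (X (k : ℕ)) (X (j : ℕ)) * s)) := by
  obtain ⟨a₀, ha₀, hlow⟩ := aux_gauss_lower X hd hX
  have hpi : 0 < √Real.pi := Real.sqrt_pos.2 Real.pi_pos
  set δ := s₀ / (2 * √a₀) with hδ
  have hδ0 : 0 < δ := by positivity
  set J := ∫ u in Set.Ioc (0:ℝ) δ, Real.exp (-u ^ 2) with hJ
  have hci : IntegrableOn (fun u : ℝ => Real.exp (-u ^ 2)) (Set.Ioc 0 δ) :=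
    (by fun_prop : Continuous fun u : ℝ => Real.exp (-u ^ 2)).integrableOn_Ioc
  have hJ0 : 0 < J := by
    rw [hJ, ← intervalIntegral.integral_of_le hδ0.le]
    exact intervalIntegral.intervalIntegral_pos_of_pos
      (by exact (by fun_prop : Continuous fun u : ℝ => Real.exp (-u ^ 2)).intervalIntegrable _ _)
      (fun _ => Real.exp_pos _) hδ0
  refine ⟨2 / √Real.pi * (J * (1 / 2)), by positivity, fun s hs m c => ?_⟩
  have hs0 : 0 < s := hs₀.trans_le hs
  obtain ⟨hi, he⟩ := aux_exp_repr hs0 (fun k : Fin m => X k) c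
  rw [he, mul_assoc]
  refine mul_le_mul_of_nonneg_left ?_ (by positivity)
  calc J * (1 / 2) * ∑ k, c k ^ 2
      = ∫ u in Set.Ioc (0:ℝ) δ, Real.exp (-u ^ 2) * (1 / 2 * ∑ k, c k ^ 2) := by
        rw [integral_mul_const, hJ, mul_assoc]
    _ ≤ ∫ u in Set.Ioc (0:ℝ) δ, Real.exp (-u ^ 2) * ∑ j, ∑ k, c k * c j *
        Real.exp (-((s / (2 * u)) ^ 2 * dist (X (k : Fin m)) (X (j : Fin m)) ^ 2)) := by
        refine setIntegral_mono_on (hci.mul_const _) (hi.mono_set Set.Ioc_subset_Ioi_self)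
          measurableSet_Ioc fun u hu => ?_
        refine mul_le_mul_of_nonneg_left (hlow _ ?_ m c) (Real.exp_nonneg _)
        have hu0 : 0 < u := hu.1
        have h1 : √a₀ ≤ s / (2 * u) := by
          rw [le_div_iff₀ (by positivity)]
          have := hu.2
          rw [hδ, le_div_iff₀ (by positivity)] at this
          linarith
        calc a₀ = √a₀ ^ 2 := (Real.sq_sqrt ha₀.le).symm
          _ ≤ _ := by gcongr
    _ ≤ _ := by
        refine setIntegral_mono_set hi ?_ (Set.Ioc_subset_Ioi_self).eventuallyLE
        filter_upwards [ae_restrict_mem measurableSet_Ioi] with u hu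
        have hu : 0 < u := hu
        exact mul_nonneg (Real.exp_nonneg _) (aux_gauss_psd (by positivity) _ c)

lemma aux_f_bounds (τ : Measure ℝ) [IsFiniteMeasure τ]
    (hτneg : τ (Set.Iio 0) = 0) (hτpos : 0 < τ (Set.Ioi 0))
    (hmom : ∫⁻ s, (ENNReal.ofReal s + (ENNReal.ofReal s)⁻¹ ^ 3) ∂τ < ⊤)
    (f : ℝ → ℝ) (hf : ∀ t, f t = ∫ s, Real.exp (-(t * s)) ∂τ)
    (X : ℕ → EuclideanSpace ℝ (Fin 3)) (hX : SeparatedSeq X) :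
    (∃ M : ℝ, 0 < M ∧ ∀ (k : ℕ) (S : Finset ℕ), ∑ j ∈ S, f (dist (X k) (X j)) ≤ M) ∧
    ∃ c₀ : ℝ, 0 < c₀ ∧ ∀ (m : ℕ) (c : Fin m → ℝ),
      c₀ * ∑ k, c k ^ 2 ≤ ∑ j, ∑ k, c k * c j * f (dist (X (k : ℕ)) (X (j : ℕ))) := by
  obtain ⟨d, hd, hX⟩ := hX
  have hpos : ∀ᵐ s ∂τ, 0 < s := by
    have h0 : ∀ᵐ s ∂τ, ENNReal.ofReal s + (ENNReal.ofReal s)⁻¹ ^ 3 < ⊤ :=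
      ae_lt_top (by fun_prop) hmom.ne
    filter_upwards [h0] with s hs
    by_contra h
    rw [ENNReal.ofReal_of_nonpos (not_lt.1 h)] at hs
    simp at hs
  have hexpi : ∀ t : ℝ, 0 ≤ t → Integrable (fun s => Real.exp (-(t * s))) τ := by
    intro t ht
    refine Integrable.mono' (integrable_const (1:ℝ)) (by fun_prop) ?_
    filter_upwards [hpos] with s hs
    rw [Real.norm_of_nonneg (Real.exp_nonneg _)]
    apply Real.exp_le_one_iff.2
    nlinarith
  have hinv : Integrable (fun s : ℝ => s⁻¹ ^ 3) τ := by
    refine ⟨by fun_prop, ?_⟩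
    refine lt_of_le_of_lt (lintegral_mono_ae ?_) hmom
    filter_upwards [hpos] with s hs
    rw [Real.enorm_of_nonneg (by positivity), ENNReal.ofReal_pow (by positivity),
      ENNReal.ofReal_inv_of_pos hs]
    exact le_add_self
  constructor
  · obtain ⟨M, hM, hpack⟩ := aux_packing X hd hX
    refine ⟨∫ s, M * (1 + s⁻¹ ^ 3) ∂τ + 1, ?_, fun k S => ?_⟩
    · have : 0 ≤ ∫ s, M * (1 + s⁻¹ ^ 3) ∂τ := by
        refine integral_nonneg_of_ae ?_
        filter_upwards [hpos] with s hs
        simp only [Pi.zero_apply]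
        positivity
      linarith
    · have h1 : ∑ j ∈ S, f (dist (X k) (X j)) =
          ∫ s, ∑ j ∈ S, Real.exp (-(dist (X k) (X j) * s)) ∂τ := by
        rw [integral_finsetSum _ fun j _ => hexpi _ dist_nonneg]
        exact Finset.sum_congr rfl fun j _ => hf _
      have h2 : ∫ s, ∑ j ∈ S, Real.exp (-(dist (X k) (X j) * s)) ∂τ
          ≤ ∫ s, M * (1 + s⁻¹ ^ 3) ∂τ := by
        refine integral_mono_ae (integrable_finsetSum _ fun j _ => hexpi _ dist_nonneg)
          (((integrable_const _).add hinv).const_mul _) ?_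
        filter_upwards [hpos] with s hs
        exact hpack s hs k S
      linarith
  · obtain ⟨s₀, hs₀, hτs⟩ : ∃ s₀ : ℝ, 0 < s₀ ∧ 0 < τ (Set.Ici s₀) := by
      by_contra! hcon
      have : Set.Ioi (0:ℝ) ⊆ ⋃ n : ℕ, Set.Ici (1 / ((n:ℝ) + 1)) := by
        intro x hx
        obtain ⟨n, hn⟩ := exists_nat_one_div_lt (Set.mem_Ioi.1 hx)
        exact Set.mem_iUnion.2 ⟨n, hn.le⟩
      have h0 : τ (⋃ n : ℕ, Set.Ici (1 / ((n:ℝ) + 1))) = 0 :=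
        measure_iUnion_null fun n => le_antisymm (hcon _ (by positivity)) zero_le
      exact hτpos.ne' (measure_mono_null this h0)
    obtain ⟨c₀, hc₀, hlow⟩ := aux_exp_lower X hd hX hs₀
    have hτr : 0 < τ.real (Set.Ici s₀) := ENNReal.toReal_pos hτs.ne' (measure_ne_top _ _)
    refine ⟨c₀ * τ.real (Set.Ici s₀), by positivity, fun m c => ?_⟩
    have hgi : Integrable (fun s => ∑ j : Fin m, ∑ k : Fin m, c k * c j *
        Real.exp (-(dist (X (k : ℕ)) (X (j : ℕ)) * s))) τ :=
      integrable_finsetSum _ fun j _ => integrable_finsetSum _ fun k _ =>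
        (hexpi _ dist_nonneg).const_mul _
    have h1 : ∑ j, ∑ k, c k * c j * f (dist (X (k : ℕ)) (X (j : ℕ))) =
        ∫ s, ∑ j : Fin m, ∑ k : Fin m, c k * c j *
          Real.exp (-(dist (X (k : ℕ)) (X (j : ℕ)) * s)) ∂τ := by
      rw [integral_finsetSum _ fun j _ => integrable_finsetSum _ fun k _ =>
        (hexpi _ dist_nonneg).const_mul _]
      refine Finset.sum_congr rfl fun j _ => ?_
      rw [integral_finsetSum _ fun k _ => (hexpi _ dist_nonneg).const_mul _]
      refine Finset.sum_congr rfl fun k _ => ?_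
      rw [integral_const_mul, hf]
    rw [h1]
    calc c₀ * τ.real (Set.Ici s₀) * ∑ k, c k ^ 2
        = ∫ s in Set.Ici s₀, c₀ * ∑ k, c k ^ 2 ∂τ := by
          rw [setIntegral_const, smul_eq_mul]; ring
      _ ≤ ∫ s in Set.Ici s₀, ∑ j : Fin m, ∑ k : Fin m, c k * c j *
          Real.exp (-(dist (X (k : ℕ)) (X (j : ℕ)) * s)) ∂τ :=
          setIntegral_mono_on (integrableOn_const (measure_ne_top _ _)) hgi.integrableOn
            measurableSet_Ici fun s hs => hlow s hs m c
      _ ≤ _ := by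
          refine setIntegral_le_integral hgi ?_
          filter_upwards [hpos] with s hs
          exact aux_exp_psd hs (fun k : Fin m => X k) c

lemma aux_quad (g : ℕ → ℕ → ℝ) (hsym : ∀ k j, g k j = g j k) (m : ℕ) (ξ : Fin m → ℂ) :
    (∑ j : Fin m, ∑ k : Fin m, ξ k * (starRingEnd ℂ) (ξ j) * (g k j : ℂ)) =
      ((∑ j : Fin m, ∑ k : Fin m, (ξ k).re * (ξ j).re * g k j +
        ∑ j : Fin m, ∑ k : Fin m, (ξ k).im * (ξ j).im * g k j : ℝ) : ℂ) := by
  apply Complex.ext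
  · simp only [Complex.re_sum, Complex.ofReal_re, ← Finset.sum_add_distrib]
    refine Finset.sum_congr rfl fun j _ => Finset.sum_congr rfl fun k _ => ?_
    simp
    ring
  · simp only [Complex.im_sum, Complex.ofReal_im]
    have h : ∀ j k : Fin m, (ξ k * (starRingEnd ℂ) (ξ j) * (g k j : ℂ)).im =
        (ξ k).im * (ξ j).re * g k j - (ξ j).im * (ξ k).re * g j k := by
      intro j k
      rw [hsym j k]
      simp
      ring
    simp only [h, Finset.sum_sub_distrib]
    rw [sub_eq_zero, Finset.sum_comm]

lemma aux_normsq {m : ℕ} (ξ : Fin m → ℂ) :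
    ∑ k, ‖ξ k‖ ^ 2 = ∑ k, (ξ k).re ^ 2 + ∑ k, (ξ k).im ^ 2 := by
  rw [← Finset.sum_add_distrib]
  refine Finset.sum_congr rfl fun k _ => ?_
  rw [Complex.sq_norm, Complex.normSq_apply]
  ring

lemma aux_op (g : ℕ → ℕ → ℝ) (hsym : ∀ k j, g k j = g j k) (hg0 : ∀ k j, 0 ≤ g k j)
    (M : ℝ) (hM : 0 < M) (hrow : ∀ (k : ℕ) (S : Finset ℕ), ∑ j ∈ S, g k j ≤ M) :
    ∃ A : ell2 →L[ℂ] ell2, ∀ k j : ℕ, A (stdBasis k) j = (g k j : ℂ) := by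
  have h2 : (0:ℝ) < (2 : ℝ≥0∞).toReal := by simp
  have hsumm : ∀ (ξ : ell2) (j : ℕ), Summable fun k => (g k j : ℂ) * ξ k := by
    intro ξ j
    have hs : Summable fun k => g k j := by
      simp only [hsym _ j]
      exact summable_of_sum_le (hg0 j) (hrow j)
    refine Summable.of_norm_bounded (hs.mul_right ‖ξ‖) fun k => ?_
    rw [norm_mul, Complex.norm_real, Real.norm_of_nonneg (hg0 k j)]
    exact mul_le_mul_of_nonneg_left (lp.norm_apply_le_norm (by simp) ξ k) (hg0 k j)
  have hfin : ∀ (ξ : ell2) (S T : Finset ℕ),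
      ∑ j ∈ S, ‖∑ k ∈ T, (g k j : ℂ) * ξ k‖ ^ 2 ≤ (M * ‖ξ‖) ^ 2 := by
    intro ξ S T
    have hj : ∀ j, ‖∑ k ∈ T, (g k j : ℂ) * ξ k‖ ^ 2 ≤ M * ∑ k ∈ T, g k j * ‖ξ k‖ ^ 2 := by
      intro j
      have h1 : ‖∑ k ∈ T, (g k j : ℂ) * ξ k‖ ≤ ∑ k ∈ T, g k j * ‖ξ k‖ := by
        refine (norm_sum_le _ _).trans (le_of_eq (Finset.sum_congr rfl fun k _ => ?_))
        rw [norm_mul, Complex.norm_real, Real.norm_of_nonneg (hg0 k j)]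
      have h3 : (∑ k ∈ T, g k j * ‖ξ k‖) ^ 2 ≤
          (∑ k ∈ T, g k j) * ∑ k ∈ T, g k j * ‖ξ k‖ ^ 2 :=
        Finset.sum_sq_le_sum_mul_sum_of_sq_le_mul T (fun k _ => hg0 k j)
          (fun k _ => mul_nonneg (hg0 k j) (sq_nonneg _)) (fun k _ => le_of_eq (by ring))
      calc _ ≤ (∑ k ∈ T, g k j * ‖ξ k‖) ^ 2 := by gcongr
        _ ≤ _ := h3
        _ ≤ _ := by
          refine mul_le_mul_of_nonneg_right ?_
            (Finset.sum_nonneg fun k _ => mul_nonneg (hg0 k j) (sq_nonneg _))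
          simp only [hsym _ j]
          exact hrow j T
    calc _ ≤ ∑ j ∈ S, M * ∑ k ∈ T, g k j * ‖ξ k‖ ^ 2 := Finset.sum_le_sum fun j _ => hj j
      _ = M * ∑ k ∈ T, (∑ j ∈ S, g k j) * ‖ξ k‖ ^ 2 := by
          rw [← Finset.mul_sum, Finset.sum_comm]
          simp only [Finset.sum_mul]
      _ ≤ M * ∑ k ∈ T, M * ‖ξ k‖ ^ 2 := by
          gcongr with k hk
          exact hrow k S
      _ ≤ M * (M * ‖ξ‖ ^ 2) := by
          rw [← Finset.mul_sum]
          gcongr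
          have := lp.sum_rpow_le_norm_rpow h2 ξ T
          simpa using this
      _ = _ := by ring
  have hbd : ∀ (ξ : ell2) (S : Finset ℕ),
      ∑ j ∈ S, ‖∑' k, (g k j : ℂ) * ξ k‖ ^ 2 ≤ (M * ‖ξ‖) ^ 2 := by
    intro ξ S
    have ht : Tendsto (fun T : Finset ℕ => ∑ j ∈ S, ‖∑ k ∈ T, (g k j : ℂ) * ξ k‖ ^ 2) atTop
        (nhds (∑ j ∈ S, ‖∑' k, (g k j : ℂ) * ξ k‖ ^ 2)) :=
      tendsto_finsetSum _ fun j _ => ((hsumm ξ j).hasSum.norm).pow 2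
    exact le_of_tendsto' ht (hfin ξ S)
  let L : ell2 →ₗ[ℂ] ell2 :=
    { toFun := fun ξ => ⟨fun j => ∑' k, (g k j : ℂ) * ξ k,
        memℓp_gen' (C := (M * ‖ξ‖) ^ 2) (by simpa using hbd ξ)⟩
      map_add' := by
        intro ξ η
        ext j
        simp only [lp.coeFn_add, Pi.add_apply, mul_add]
        exact (hsumm ξ j).tsum_add (hsumm η j)
      map_smul' := by
        intro z ξ
        ext j
        simp only [lp.coeFn_smul, Pi.smul_apply, smul_eq_mul, RingHom.id_apply]
        rw [← tsum_mul_left]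
        exact tsum_congr fun k => by ring }
  refine ⟨L.mkContinuous M fun ξ => ?_, fun k j => ?_⟩
  · refine lp.norm_le_of_forall_sum_le h2 (by positivity) fun S => ?_
    simpa [L] using hbd ξ S
  · show ∑' i, (g i j : ℂ) * (stdBasis k) i = _
    rw [tsum_eq_single k]
    · simp [stdBasis]
    · intro i hi
      simp [stdBasis, Pi.single_eq_of_ne hi]

lemma aux_op_inv (g : ℕ → ℕ → ℝ) (hsym : ∀ k j, g k j = g j k) (A : ell2 →L[ℂ] ell2)
    (hA : ∀ k j : ℕ, A (stdBasis k) j = (g k j : ℂ)) (c : ℝ) (hc : 0 < c)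
    (hlow : ∀ (m : ℕ) (ξ : Fin m → ℂ), ((c * ∑ k, ‖ξ k‖ ^ 2 : ℝ) : ℂ) ≤
      ∑ j : Fin m, ∑ k : Fin m, ξ k * (starRingEnd ℂ) (ξ j) * (g k j : ℂ)) :
    IsSelfAdjoint A ∧ ∃ B : ell2 →L[ℂ] ell2, A.comp B = ContinuousLinearMap.id ℂ ell2 ∧
          B.comp A = ContinuousLinearMap.id ℂ ell2 := by
  have hcoord : ∀ (x : ell2) (j : ℕ), inner ℂ (stdBasis j) x = x j := by
    intro x j
    rw [stdBasis, lp.inner_single_left]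
    simp
  have hsa : IsSelfAdjoint A := by
    rw [ContinuousLinearMap.isSelfAdjoint_iff']
    refine lp.ext_continuousLinearMap (by simp) fun k => ?_
    ext j
    show (A.adjoint (stdBasis k)) j = A (stdBasis k) j
    rw [← hcoord, ContinuousLinearMap.adjoint_inner_right, ← inner_conj_symm, hcoord, hA, hA,
      Complex.conj_ofReal, hsym]
  refine ⟨hsa, ?_⟩
  have hform : ∀ x : ell2, c * ‖x‖ ^ 2 ≤ (inner ℂ (A x) x).re := by
    intro x
    set p : ℕ → ell2 := fun m => ∑ k ∈ Finset.range m, x k • stdBasis k with hp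
    have hpt : Tendsto p atTop (nhds x) := by
      have h := (lp.hasSum_single (by simp : (2 : ℝ≥0∞) ≠ ⊤) x).tendsto_sum_nat
      convert h using 4 with m k
      rw [stdBasis, ← lp.single_smul]
      simp
    have hpb : ∀ m, c * ‖p m‖ ^ 2 ≤ (inner ℂ (A (p m)) (p m)).re := by
      intro m
      have h1 : ∀ (y : ell2), inner ℂ y (p m) = ∑ k : Fin m, x k * (starRingEnd ℂ) (y k) := by
        intro y
        rw [hp]
        simp only [inner_sum, inner_smul_right]
        rw [Finset.sum_range]
        refine Finset.sum_congr rfl fun k _ => ?_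
        rw [← inner_conj_symm, hcoord]
      have hpk : ∀ k : Fin m, p m k = x k := by
        intro k
        rw [← hcoord, hp]
        simp only [inner_sum, inner_smul_right]
        simp only [hcoord]
        rw [Finset.sum_eq_single (k : ℕ)]
        · simp [stdBasis]
        · intro i _ hi
          simp [stdBasis, Pi.single_eq_of_ne hi.symm]
        · intro h; exact absurd (Finset.mem_range.2 k.2) h
      have hn : ‖p m‖ ^ 2 = ∑ k : Fin m, ‖x k‖ ^ 2 := by
        have h3 := inner_self_eq_norm_sq_to_K (𝕜 := ℂ) (p m)
        rw [h1] at h3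
        apply Complex.ofReal_injective
        push_cast
        rw [← Complex.coe_algebraMap] at *
        rw [← h3]
        refine Finset.sum_congr rfl fun k _ => ?_
        rw [hpk, Complex.mul_conj, Complex.normSq_eq_norm_sq]
        simp
      have hAk : ∀ k : Fin m, A (p m) k = ∑ i : Fin m, x i * (g i k : ℂ) := by
        intro k
        rw [← hcoord, hp]
        simp only [map_sum, map_smul, inner_sum, inner_smul_right]
        simp only [hcoord, hA]
        rw [Finset.sum_range]
      have h4 := hlow m (fun k => x k)
      rw [hn, h1]
      have h5 := (Complex.le_def.1 h4).1
      rw [Complex.ofReal_re] at h5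
      refine h5.trans (le_of_eq ?_)
      congr 1
      rw [Finset.sum_comm]
      refine Finset.sum_congr rfl fun k _ => ?_
      rw [hAk, map_sum, Finset.mul_sum]
      refine Finset.sum_congr rfl fun i _ => ?_
      rw [map_mul, Complex.conj_ofReal, hsym]
      ring
    have hl : Tendsto (fun m => c * ‖p m‖ ^ 2) atTop (nhds (c * ‖x‖ ^ 2)) :=
      (hpt.norm.pow 2).const_mul c
    have hr : Tendsto (fun m => (inner ℂ (A (p m)) (p m)).re) atTop
        (nhds (inner ℂ (A x) x).re) :=
      (Complex.continuous_re.tendsto _).comp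
        (((A.continuous.tendsto x).comp hpt).inner hpt)
    exact le_of_tendsto_of_tendsto' hl hr hpb
  have hunit : IsUnit A := by
    refine A.isUnit_of_forall_le_norm_inner_map (c := ⟨c, hc.le⟩) hc fun x => ?_
    have h1 := hform x
    have h2 := Complex.re_le_norm (inner ℂ (A x) x)
    show ‖x‖ ^ 2 * c ≤ _
    linarith
  obtain ⟨B, h1, h2⟩ := isUnit_iff_exists.1 hunit
  exact ⟨B, h1, h2⟩

/-- Let `τ` be a finite positive Borel measure on `[0,∞)` with
`τ((0,∞)) > 0` and `∫ (s + s⁻³) dτ(s) < ∞`, let `f(t) = ∫ e^{−ts} dτ(s)`, and let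
`X ⊂ ℝ³` satisfy `d_*(X) > 0`. Then the Gram matrix `(f(|x_k − x_j|))_{k,j}` defines a
bounded self-adjoint operator on `ℓ²(ℕ)` with bounded inverse; equivalently, there are
`0 < c ≤ C` with `c ∑|ξ_k|² ≤ ∑_{j,k} f(|x_k−x_j|) ξ_k conj(ξ_j) ≤ C ∑|ξ_k|²`. -/
theorem statement_4 (τ : Measure ℝ) [IsFiniteMeasure τ]
    (hτneg : τ (Set.Iio 0) = 0) (hτpos : 0 < τ (Set.Ioi 0))
    (hmom : ∫⁻ s, (ENNReal.ofReal s + (ENNReal.ofReal s)⁻¹ ^ 3) ∂τ < ⊤)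
    (f : ℝ → ℝ) (hf : ∀ t, f t = ∫ s, Real.exp (-(t * s)) ∂τ)
    (X : ℕ → EuclideanSpace ℝ (Fin 3)) (hX : SeparatedSeq X) :
    (∃ A : ell2 →L[ℂ] ell2, IsSelfAdjoint A ∧
        (∀ k j : ℕ, A (stdBasis k) j = (f (dist (X k) (X j)) : ℂ)) ∧
        ∃ B : ell2 →L[ℂ] ell2, A.comp B = ContinuousLinearMap.id ℂ ell2 ∧
          B.comp A = ContinuousLinearMap.id ℂ ell2) ∧
      (∃ c C : ℝ, 0 < c ∧ c ≤ C ∧ ∀ (m : ℕ) (ξ : Fin m → ℂ),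
        ((c * ∑ k, ‖ξ k‖ ^ 2 : ℝ) : ℂ) ≤
            (∑ j, ∑ k, ξ k * (starRingEnd ℂ) (ξ j) * (f (dist (X (k : ℕ)) (X (j : ℕ))) : ℂ)) ∧
          (∑ j, ∑ k, ξ k * (starRingEnd ℂ) (ξ j) * (f (dist (X (k : ℕ)) (X (j : ℕ))) : ℂ)) ≤
            ((C * ∑ k, ‖ξ k‖ ^ 2 : ℝ) : ℂ)) := by
  obtain ⟨⟨M, hM, hrow⟩, c₀, hc₀, hlow⟩ := aux_f_bounds τ hτneg hτpos hmom f hf X hX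
  have hsym : ∀ k j : ℕ, f (dist (X k) (X j)) = f (dist (X j) (X k)) := fun k j => by
    rw [dist_comm]
  have hnn : ∀ k j : ℕ, 0 ≤ f (dist (X k) (X j)) := fun k j => by
    rw [hf]
    exact integral_nonneg fun _ => Real.exp_nonneg _
  have hquad := aux_quad (fun k j => f (dist (X k) (X j))) hsym
  have hL : ∀ (m : ℕ) (ξ : Fin m → ℂ), ((c₀ * ∑ k, ‖ξ k‖ ^ 2 : ℝ) : ℂ) ≤
      (∑ j, ∑ k, ξ k * (starRingEnd ℂ) (ξ j) *
        (f (dist (X (k : ℕ)) (X (j : ℕ))) : ℂ)) := by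
    intro m ξ
    rw [hquad m ξ, Complex.real_le_real, aux_normsq, mul_add]
    exact add_le_add (hlow m fun k => (ξ k).re) (hlow m fun k => (ξ k).im)
  have hU : ∀ (m : ℕ) (ξ : Fin m → ℂ), (∑ j, ∑ k, ξ k * (starRingEnd ℂ) (ξ j) *
        (f (dist (X (k : ℕ)) (X (j : ℕ))) : ℂ)) ≤ ((M * ∑ k, ‖ξ k‖ ^ 2 : ℝ) : ℂ) := by
    intro m ξ
    have hs := aux_schur (fun k j : Fin m => f (dist (X (k : ℕ)) (X (j : ℕ))))
      (fun k j => hsym k j) M (fun k => by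
        simp only [abs_of_nonneg (hnn _ _)]
        have := hrow k (Finset.range m)
        rwa [Finset.sum_range] at this)
    rw [hquad m ξ, Complex.real_le_real, aux_normsq, mul_add]
    exact add_le_add ((le_abs_self _).trans (hs fun k => (ξ k).re))
      ((le_abs_self _).trans (hs fun k => (ξ k).im))
  refine ⟨?_, c₀, max c₀ M, hc₀, le_max_left _ _, fun m ξ => ⟨hL m ξ, (hU m ξ).trans ?_⟩⟩
  · obtain ⟨A, hA⟩ := aux_op (fun k j => f (dist (X k) (X j))) hsym hnn M hM hrow
    obtain ⟨hsa, hB⟩ := aux_op_inv (fun k j => f (dist (X k) (X j))) hsym A hA c₀ hc₀ hL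
    exact ⟨A, hsa, hA, hB⟩
  · rw [Complex.real_le_real]
    exact mul_le_mul_of_nonneg_right (le_max_right _ _)
      (Finset.sum_nonneg fun k _ => sq_nonneg _)
end
end

section
/- Let τ be a finite positive Borel measure on [0,∞) with τ((0,∞)) > 0, let f(t) = ∫_0^∞ e^{−ts} dτ(s), and let X = {x_k}_{k≥1} be a sequence of pairwise distinct points of ℝ³. If the Gram matrix Gr_X(f) = (f(|x_k − x_j|))_{k,j∈ℕ} defines a bounded operator on ℓ²(ℕ) which has a bounded inverse, then d_*(X) > 0. -/
open MeasureTheory Filter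
open scoped ComplexOrder ENNReal RealInnerProductSpace

noncomputable section

section helpers
variable {τ : Measure ℝ} [IsFiniteMeasure τ]

lemma aux_ae (hτneg : τ (Set.Iio 0) = 0) : ∀ᵐ s ∂τ, 0 ≤ s := by
  rw [ae_iff]
  simpa [Set.Iio] using hτneg

lemma aux_bound {t s : ℝ} (ht : 0 ≤ t) (hs : 0 ≤ s) : ‖Real.exp (-(t * s))‖ ≤ 1 := by
  rw [Real.norm_eq_abs, abs_of_pos (Real.exp_pos _), Real.exp_le_one_iff]
  have := mul_nonneg ht hs
  linarith

lemma aux_int (hτneg : τ (Set.Iio 0) = 0) {t : ℝ} (ht : 0 ≤ t) :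
    Integrable (fun s => Real.exp (-(t * s))) τ := by
  refine Integrable.of_bound (C := 1) (by fun_prop) ?_
  filter_upwards [aux_ae hτneg] with s hs using aux_bound ht hs

lemma aux_anti (hτneg : τ (Set.Iio 0) = 0) {t u : ℝ} (ht : 0 ≤ t) (h : t ≤ u) :
    ∫ s, Real.exp (-(u * s)) ∂τ ≤ ∫ s, Real.exp (-(t * s)) ∂τ := by
  refine integral_mono_ae (aux_int hτneg (ht.trans h)) (aux_int hτneg ht) ?_
  filter_upwards [aux_ae hτneg] with s hs
  apply Real.exp_le_exp.2
  have := mul_le_mul_of_nonneg_right h hs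
  linarith

lemma aux_cheb (hτneg : τ (Set.Iio 0) = 0) {m : ℝ} (hm : 0 < m) {t δ : ℝ} (ht : 0 ≤ t)
    (hδ : 0 < δ) (hmm : ∫ s, Real.exp (-(δ * s)) ∂τ = m * τ.real Set.univ) :
    m * ∫ s, Real.exp (-(t * s)) ∂τ ≤ ∫ s, Real.exp (-((t + δ) * s)) ∂τ := by
  obtain ⟨s0, hs0⟩ : ∃ s0 : ℝ, Real.exp (-(δ * s0)) = m := by
    refine ⟨-Real.log m / δ, ?_⟩
    rw [mul_div_cancel₀ _ hδ.ne', neg_neg, Real.exp_log hm]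
  set c := Real.exp (-(t * s0)) with hc
  have h1 := aux_int hτneg ht
  have h2 := aux_int hτneg hδ.le
  have h3 := aux_int (τ := τ) hτneg (add_nonneg ht hδ.le)
  have key : ∫ s, (m * Real.exp (-(t * s)) + c * (Real.exp (-(δ * s)) - m)) ∂τ
      ≤ ∫ s, Real.exp (-((t + δ) * s)) ∂τ := by
    refine integral_mono ((h1.const_mul m).add ((h2.sub (integrable_const m)).const_mul c)) h3 ?_
    intro s
    have e : Real.exp (-((t + δ) * s)) = Real.exp (-(t * s)) * Real.exp (-(δ * s)) := by
      rw [← Real.exp_add]; ring_nf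
    have : 0 ≤ (Real.exp (-(t * s)) - c) * (Real.exp (-(δ * s)) - m) := by
      rw [← hs0, hc]
      rcases le_total s s0 with h | h
      · apply mul_nonneg <;> rw [sub_nonneg] <;> apply Real.exp_le_exp.2 <;> nlinarith
      · apply mul_nonneg_of_nonpos_of_nonpos <;> rw [sub_nonpos] <;>
          apply Real.exp_le_exp.2 <;> nlinarith
    simp only [e]
    nlinarith
  have h4 : Integrable (fun s => c * (Real.exp (-(δ * s)) - m)) τ :=
    (h2.sub (integrable_const m)).const_mul c
  rw [integral_add (h1.const_mul m) h4,
    integral_const_mul, integral_const_mul, integral_sub h2 (integrable_const m), hmm,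
    integral_const, smul_eq_mul] at key
  nlinarith

lemma aux_tendsto (hτneg : τ (Set.Iio 0) = 0) :
    Tendsto (fun t => ∫ s, Real.exp (-(t * s)) ∂τ) (nhdsWithin 0 (Set.Ici 0))
      (nhds (τ.real Set.univ)) := by
  have : τ.real Set.univ = ∫ s, (1:ℝ) ∂τ := by simp
  rw [this]
  refine tendsto_integral_filter_of_dominated_convergence (fun _ => 1) ?_ ?_
    (integrable_const _) ?_
  · exact Eventually.of_forall fun t => by fun_prop
  · filter_upwards [self_mem_nhdsWithin] with t ht
    filter_upwards [aux_ae hτneg] with s hs using aux_bound ht hs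
  · refine Eventually.of_forall fun s => ?_
    have hc : Continuous fun t : ℝ => Real.exp (-(t * s)) := by fun_prop
    have := (hc.tendsto 0).mono_left (nhdsWithin_le_nhds (s := Set.Ici 0))
    simpa using this

end helpers

lemma aux_lp_mono (u v : ell2) (ε : ℝ) (hε : 0 ≤ ε) (h : ∀ l, ‖u l‖ ≤ ε * ‖v l‖) :
    ‖u‖ ≤ ε * ‖v‖ := by
  have h2 : 0 < (2 : ENNReal).toReal := by norm_num
  refine lp.norm_le_of_forall_sum_le h2 (by positivity) fun s => ?_
  rw [Real.mul_rpow hε (norm_nonneg _)]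
  calc ∑ i ∈ s, ‖u i‖ ^ (2:ENNReal).toReal
      ≤ ∑ i ∈ s, ε ^ (2:ENNReal).toReal * ‖v i‖ ^ (2:ENNReal).toReal := by
        refine Finset.sum_le_sum fun i _ => ?_
        rw [← Real.mul_rpow hε (norm_nonneg _)]
        exact Real.rpow_le_rpow (norm_nonneg _) (h i) h2.le
    _ ≤ _ := by
        rw [← Finset.mul_sum]
        exact mul_le_mul_of_nonneg_left (lp.sum_rpow_le_norm_rpow h2 v s) (by positivity)

/-- Let `τ` be a finite positive Borel measure on `[0,∞)` with
`τ((0,∞)) > 0`, `f(t) = ∫ e^{−ts} dτ(s)`, and let `X` be a sequence of pairwise distinct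
points of `ℝ³`. If the Gram matrix `(f(|x_k − x_j|))_{k,j}` defines a bounded operator on
`ℓ²(ℕ)` with bounded inverse, then `d_*(X) > 0`. -/
theorem statement_5 (τ : Measure ℝ) [IsFiniteMeasure τ]
    (hτneg : τ (Set.Iio 0) = 0) (hτpos : 0 < τ (Set.Ioi 0))
    (f : ℝ → ℝ) (hf : ∀ t, f t = ∫ s, Real.exp (-(t * s)) ∂τ)
    (X : ℕ → EuclideanSpace ℝ (Fin 3)) (hX : Function.Injective X)
    (hbdd : ∃ A : ell2 →L[ℂ] ell2,
      (∀ k j : ℕ, A (stdBasis k) j = (f (dist (X k) (X j)) : ℂ)) ∧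
      ∃ B : ell2 →L[ℂ] ell2, A.comp B = ContinuousLinearMap.id ℂ ell2 ∧
        B.comp A = ContinuousLinearMap.id ℂ ell2) :
    SeparatedSeq X := by
  obtain ⟨A, hA, B, -, hBA⟩ := hbdd
  set M := τ.real Set.univ with hM
  have hMpos : 0 < M := by
    rw [hM, Measure.real, ENNReal.toReal_pos_iff]
    exact ⟨hτpos.trans_le (measure_mono (Set.subset_univ _)), measure_lt_top _ _⟩
  have hnn : ∀ t, 0 ≤ f t := fun t => by
    rw [hf]; exact integral_nonneg fun s => (Real.exp_pos _).le
  have hanti : ∀ {t u}, 0 ≤ t → t ≤ u → f u ≤ f t := fun ht h => by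
    rw [hf, hf]; exact aux_anti hτneg ht h
  have hf0 : f 0 = M := by rw [hf]; simp [hM]
  -- choose ε and d
  set ε : ℝ := 1 / (2 * (‖B‖ * ‖A‖ + 1)) with hεdef
  have hAB : 0 ≤ ‖B‖ * ‖A‖ := by positivity
  have hε : 0 < ε := by positivity
  have hε1 : ε < 1 := by
    rw [hεdef, div_lt_one (by positivity)]; linarith
  have hev : ∀ᶠ t in nhdsWithin (0:ℝ) (Set.Ici 0), (1 - ε) * M < f t := by
    have := aux_tendsto hτneg
    simp only [← hf] at this
    exact this.eventually_const_lt (by nlinarith)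
  obtain ⟨d, hd, hdf⟩ := Metric.eventually_nhds_iff.1 (eventually_nhdsWithin_iff.1 hev)
  refine ⟨d, hd, fun k j hkj => ?_⟩
  by_contra! hlt
  -- one-sided estimate
  have est : ∀ a b, 0 ≤ a → a ≤ b → b - a < d → f a - f b ≤ ε * f a := by
    intro a b ha hab hbd
    rcases hab.eq_or_lt with rfl | hab
    · have := mul_nonneg hε.le (hnn a); linarith
    have h1 : (1 - ε) * M < f (b - a) := hdf (by
      rw [Real.dist_eq, sub_zero, abs_of_pos (by linarith)]; exact hbd) (by
      simp only [Set.mem_Ici]; linarith)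
    have hpos : 0 < f (b - a) := lt_of_le_of_lt (mul_nonneg (by linarith) hMpos.le) h1
    have h2 := aux_cheb hτneg (m := f (b - a) / M) (by positivity) ha (δ := b - a) (by linarith)
      (by rw [← hf, ← hM]; field_simp)
    rw [← hf, ← hf, add_sub_cancel] at h2
    have h3 : 1 - ε ≤ f (b - a) / M := by rw [le_div_iff₀ hMpos]; exact h1.le
    have := mul_le_mul_of_nonneg_right h3 (hnn a)
    linarith
  have est2 : ∀ a b, 0 ≤ a → 0 ≤ b → |a - b| < d → |f a - f b| ≤ ε * (f a + f b) := by
    intro a b ha hb hab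
    rw [abs_lt] at hab
    have p1 := mul_nonneg hε.le (hnn a)
    have p2 := mul_nonneg hε.le (hnn b)
    rcases le_total a b with h | h
    · have := est a b ha h (by linarith)
      rw [abs_of_nonneg (sub_nonneg.2 (hanti ha h))]; linarith
    · have := est b a hb h (by linarith)
      rw [abs_sub_comm, abs_of_nonneg (sub_nonneg.2 (hanti hb h))]; linarith
  have hsmall : ‖A (stdBasis k) - A (stdBasis j)‖ ≤ ε * ‖A (stdBasis k) + A (stdBasis j)‖ := by
    refine aux_lp_mono _ _ ε hε.le fun l => ?_
    rw [lp.coeFn_sub, lp.coeFn_add, Pi.sub_apply, Pi.add_apply, hA, hA, ← Complex.ofReal_sub,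
      ← Complex.ofReal_add, Complex.norm_real, Complex.norm_real, Real.norm_eq_abs,
      Real.norm_eq_abs, abs_of_nonneg (add_nonneg (hnn _) (hnn _))]
    exact est2 _ _ dist_nonneg dist_nonneg ((abs_dist_sub_le _ _ _).trans_lt hlt)
  have hn : ∀ k, ‖stdBasis k‖ = 1 := fun k => by
    simp [stdBasis, lp.norm_single]
  have hlow : 1 ≤ ‖stdBasis k - stdBasis j‖ := by
    have := lp.norm_apply_le_norm (p := 2) (by norm_num) (stdBasis k - stdBasis j) k
    rw [lp.coeFn_sub, Pi.sub_apply] at this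
    simpa [stdBasis, lp.single_apply, Pi.single_apply, hkj] using this
  have hB : stdBasis k - stdBasis j = B (A (stdBasis k) - A (stdBasis j)) := by
    rw [← map_sub]
    exact (DFunLike.congr_fun hBA (stdBasis k - stdBasis j)).symm
  have hup : ‖A (stdBasis k) + A (stdBasis j)‖ ≤ 2 * ‖A‖ := by
    have h1 := A.le_opNorm (stdBasis k)
    have h2 := A.le_opNorm (stdBasis j)
    rw [hn, mul_one] at h1 h2
    linarith [norm_add_le (A (stdBasis k)) (A (stdBasis j))]
  have hfin : 1 ≤ ‖B‖ * (ε * (2 * ‖A‖)) := by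
    refine hlow.trans ?_
    rw [hB]
    refine (B.le_opNorm _).trans (mul_le_mul_of_nonneg_left ?_ (norm_nonneg _))
    exact hsmall.trans (mul_le_mul_of_nonneg_left hup hε.le)
  have : ε * (2 * (‖B‖ * ‖A‖ + 1)) = 1 := by
    rw [hεdef]; field_simp
  nlinarith
end
end

section
/- Let τ be a finite positive Borel measure on [0,∞) with τ((0,∞)) > 0 and ∫_0^∞ (s + s^{−3}) dτ(s) < ∞, and let X = {x_j}_{j≥1} be a sequence of pairwise distinct points of ℝ³. Define φ̃_j ∈ L²(ℝ³) by φ̃_j(x) = (2π)^{−1/2} ∫_0^∞ (e^{−s|x−x_j|}/|x−x_j|) dτ(s). Then the sequence {φ̃_j}_{j≥1} forms a Riesz basis of the closure of its linear span in L²(ℝ³) (i.e. it is simultaneously a Riesz-Fischer sequence and a Bessel sequence) if and only if d_*(X) > 0. -/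
open MeasureTheory Filter
open scoped ComplexOrder ENNReal RealInnerProductSpace

noncomputable section

/-- Sum over separated far points of a radially decreasing integrable kernel. -/
lemma far_sum_le (G : ℝ → ℝ) (hG0 : ∀ r, 0 ≤ r → 0 ≤ G r) (hanti : AntitoneOn G (Set.Ioi 0))
    (hint : Integrable (fun x : E3 => G ‖x‖)) (d : ℝ) (hd : 0 < d) {ι : Type*} (S : Finset ι)
    (p : ι → E3) (hsep : ∀ i ∈ S, ∀ j ∈ S, i ≠ j → d ≤ dist (p i) (p j)) (x : E3)
    (hfar : ∀ i ∈ S, d / 2 ≤ dist x (p i)) :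
    ∑ i ∈ S, G (dist x (p i)) ≤
      (∫ y : E3, G ‖y‖) / (volume : Measure E3).real (Metric.ball 0 (d / 4)) := by
  have hv : 0 < (volume : Measure E3).real (Metric.ball 0 (d / 4)) := by
    rw [Measure.real, ENNReal.toReal_pos_iff]
    exact ⟨Metric.measure_ball_pos _ _ (by positivity), measure_ball_lt_top⟩
  rw [le_div_iff₀ hv, Finset.sum_mul]
  have hint' : Integrable (fun y : E3 => G (dist x y)) := by
    have := hint.comp_sub_left x
    simpa [dist_eq_norm] using this
  have hI : (∫ y : E3, G ‖y‖) = ∫ y : E3, G (dist x y) := by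
    have := integral_sub_left_eq_self (fun y : E3 => G ‖y‖) (volume : Measure E3) x
    rw [← this]; simp [dist_eq_norm]
  set z : ι → E3 := fun i => AffineMap.lineMap (p i) x ((d / 4) / dist x (p i)) with hz
  have hz1 : ∀ i ∈ S, dist (z i) (p i) = d / 4 := by
    intro i hi
    have h := hfar i hi
    have h0 : 0 < dist x (p i) := by linarith
    rw [hz, dist_lineMap_left, Real.norm_of_nonneg (by positivity), dist_comm (p i) x]
    field_simp
  have hz2 : ∀ i ∈ S, dist x (z i) = dist x (p i) - d / 4 := by
    intro i hi
    have h := hfar i hi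
    have h0 : 0 < dist x (p i) := by linarith
    have h1 : (d / 4) / dist x (p i) ≤ 1 := by
      rw [div_le_one h0]; linarith
    rw [dist_comm, hz, dist_lineMap_right, Real.norm_of_nonneg (by linarith), dist_comm (p i) x]
    field_simp
  have hdisj : Set.Pairwise (↑S) (Function.onFun Disjoint fun i => Metric.ball (z i) (d / 4)) := by
    intro i hi j hj hij
    refine Set.disjoint_left.2 fun y hy1 hy2 => ?_
    rw [Metric.mem_ball] at hy1 hy2
    have := hsep i hi j hj hij
    have h1 := hz1 i hi
    have h2 := hz1 j hj
    have t1 := dist_triangle (p i) (z i) y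
    have t2 := dist_triangle (p i) y (p j)
    have t3 := dist_triangle y (z j) (p j)
    rw [dist_comm (p i) (z i), dist_comm (z i) y] at t1
    linarith
  calc ∑ i ∈ S, G (dist x (p i)) * (volume : Measure E3).real (Metric.ball 0 (d / 4))
      ≤ ∑ i ∈ S, ∫ y in Metric.ball (z i) (d / 4), G (dist x y) := by
        refine Finset.sum_le_sum fun i hi => ?_
        have hvol : (volume : Measure E3).real (Metric.ball 0 (d / 4)) =
            (volume : Measure E3).real (Metric.ball (z i) (d / 4)) := by
          rw [Measure.real, Measure.real, Measure.addHaar_ball_center volume (z i)]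
        rw [hvol, mul_comm, ← smul_eq_mul, ← setIntegral_const]
        refine setIntegral_mono_on ?_ hint'.integrableOn measurableSet_ball ?_
        · exact integrableOn_const (by exact measure_ball_lt_top.ne)
        · intro y hy
          rw [Metric.mem_ball] at hy
          have h := hfar i hi
          have h2 := hz2 i hi
          have t1 := dist_triangle x y (z i)
          have t2 := dist_triangle x (z i) y
          rw [dist_comm (z i) y] at t2
          apply hanti
          · simp only [Set.mem_Ioi]; linarith
          · simp only [Set.mem_Ioi]; linarith
          · linarith
    _ = ∫ y in ⋃ i ∈ S, Metric.ball (z i) (d / 4), G (dist x y) := by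
        rw [integral_biUnion_finset S (fun _ _ => measurableSet_ball) hdisj
          (fun _ _ => hint'.integrableOn)]
    _ ≤ ∫ y, G (dist x y) :=
        setIntegral_le_integral hint' (Eventually.of_forall fun y => hG0 _ dist_nonneg)
    _ = _ := hI.symm

/-- Weighted Cauchy–Schwarz. -/
lemma schur_cs {ι : Type*} (S : Finset ι) (ξ : ι → ℂ) (a : ι → ℝ) (ha : ∀ i ∈ S, 0 ≤ a i)
    (M : ℝ) (hM : ∑ i ∈ S, a i ≤ M) :
    ‖∑ i ∈ S, ξ i * (a i : ℂ)‖ ^ 2 ≤ M * ∑ i ∈ S, ‖ξ i‖ ^ 2 * a i := by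
  have h1 : ‖∑ i ∈ S, ξ i * (a i : ℂ)‖ ≤ ∑ i ∈ S, ‖ξ i‖ * a i := by
    refine (norm_sum_le _ _).trans (Finset.sum_le_sum fun i hi => ?_)
    rw [norm_mul, Complex.norm_real, Real.norm_of_nonneg (ha i hi)]
  have h2 : (∑ i ∈ S, ‖ξ i‖ * a i) ^ 2 ≤ (∑ i ∈ S, a i) * ∑ i ∈ S, ‖ξ i‖ ^ 2 * a i := by
    apply Finset.sum_sq_le_sum_mul_sum_of_sq_le_mul S ha
    · intro i hi; have := ha i hi; positivity
    · intro i hi; apply le_of_eq; ring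
  calc ‖∑ i ∈ S, ξ i * (a i : ℂ)‖ ^ 2 ≤ (∑ i ∈ S, ‖ξ i‖ * a i) ^ 2 := by gcongr
    _ ≤ (∑ i ∈ S, a i) * ∑ i ∈ S, ‖ξ i‖ ^ 2 * a i := h2
    _ ≤ _ := by
      have : 0 ≤ ∑ i ∈ S, ‖ξ i‖ ^ 2 * a i :=
        Finset.sum_nonneg fun i hi => mul_nonneg (by positivity) (ha i hi)
      gcongr

/-- Pointwise upper bound. -/
lemma pointwise_upper (G : ℝ → ℝ) (hG0 : ∀ r, 0 ≤ r → 0 ≤ G r) (d M : ℝ)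
    (m : ℕ) (p : Fin m → E3) (hsep : ∀ i j, i ≠ j → d ≤ dist (p i) (p j))
    (hM : ∀ (S : Finset (Fin m)) (x : E3), (∀ i ∈ S, d / 2 ≤ dist x (p i)) →
      ∑ i ∈ S, G (dist x (p i)) ≤ M) (hM0 : 0 ≤ M) (ξ : Fin m → ℂ) (x : E3) :
    ‖∑ i, ξ i * (G (dist x (p i)) : ℂ)‖ ^ 2 ≤
      ∑ i, ‖ξ i‖ ^ 2 * (2 * (G (dist x (p i)) ^ 2 + M * G (dist x (p i)))) := by
  classical
  set N := Finset.univ.filter fun i => dist x (p i) < d / 2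
  set R := Finset.univ.filter fun i => ¬ dist x (p i) < d / 2
  have hsplit : ∑ i, ξ i * (G (dist x (p i)) : ℂ) =
      ∑ i ∈ N, ξ i * (G (dist x (p i)) : ℂ) + ∑ i ∈ R, ξ i * (G (dist x (p i)) : ℂ) :=
    (Finset.sum_filter_add_sum_filter_not _ _ _).symm
  have hN : ‖∑ i ∈ N, ξ i * (G (dist x (p i)) : ℂ)‖ ^ 2 ≤
      ∑ i, ‖ξ i‖ ^ 2 * G (dist x (p i)) ^ 2 := by
    have hcard : N.card ≤ 1 := by
      rw [Finset.card_le_one]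
      intro i hi j hj
      by_contra hij
      simp only [N, Finset.mem_filter, Finset.mem_univ, true_and] at hi hj
      have := hsep i j hij
      have := dist_triangle_left (p i) (p j) x
      linarith
    have hsub : ∑ i ∈ N, ‖ξ i‖ ^ 2 * G (dist x (p i)) ^ 2 ≤
        ∑ i, ‖ξ i‖ ^ 2 * G (dist x (p i)) ^ 2 :=
      Finset.sum_le_sum_of_subset_of_nonneg (Finset.subset_univ _) fun i _ _ => by positivity
    refine le_trans ?_ hsub
    rcases Nat.le_one_iff_eq_zero_or_eq_one.1 hcard with h0 | h1
    · rw [Finset.card_eq_zero] at h0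
      rw [h0]; simp
    · obtain ⟨a, ha⟩ := Finset.card_eq_one.1 h1
      rw [ha]; simp [mul_pow]
  have hR : ‖∑ i ∈ R, ξ i * (G (dist x (p i)) : ℂ)‖ ^ 2 ≤
      M * ∑ i, ‖ξ i‖ ^ 2 * G (dist x (p i)) := by
    refine (schur_cs R ξ _ (fun i _ => hG0 _ dist_nonneg) M (hM R x ?_)).trans ?_
    · intro i hi
      simpa [R] using hi
    · refine mul_le_mul_of_nonneg_left ?_ hM0
      exact Finset.sum_le_sum_of_subset_of_nonneg (Finset.subset_univ _)
        fun i _ _ => mul_nonneg (by positivity) (hG0 _ dist_nonneg)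
  have key : ∀ a b : ℂ, ‖a + b‖ ^ 2 ≤ 2 * ‖a‖ ^ 2 + 2 * ‖b‖ ^ 2 := by
    intro a b
    have := norm_add_le a b
    nlinarith [sq_nonneg (‖a‖ - ‖b‖), norm_nonneg (a + b)]
  rw [hsplit]
  refine (key _ _).trans ?_
  have : ∑ i, ‖ξ i‖ ^ 2 * (2 * (G (dist x (p i)) ^ 2 + M * G (dist x (p i)))) =
      2 * ∑ i, ‖ξ i‖ ^ 2 * G (dist x (p i)) ^ 2 +
      2 * (M * ∑ i, ‖ξ i‖ ^ 2 * G (dist x (p i))) := by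
    rw [Finset.mul_sum, Finset.mul_sum, Finset.mul_sum, ← Finset.sum_add_distrib]
    exact Finset.sum_congr rfl fun i _ => by ring
  rw [this]
  linarith

/-- Pointwise lower bound. -/
lemma pointwise_lower (G : ℝ → ℝ) (hG0 : ∀ r, 0 ≤ r → 0 ≤ G r) (d M : ℝ)
    (m : ℕ) (p : Fin m → E3) (hsep : ∀ i j, i ≠ j → d ≤ dist (p i) (p j))
    (hM : ∀ (S : Finset (Fin m)) (x : E3), (∀ i ∈ S, d / 2 ≤ dist x (p i)) →
      ∑ i ∈ S, G (dist x (p i)) ≤ M) (hM0 : 0 ≤ M) (ξ : Fin m → ℂ) (y : E3) (hy : ‖y‖ ≤ d / 2) :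
    G ‖y‖ ^ 2 * ∑ i, ‖ξ i‖ ^ 2 ≤
      2 * (∑ j, ‖∑ i, ξ i * (G (dist (y + p j) (p i)) : ℂ)‖ ^ 2) +
        2 * M ^ 2 * ∑ i, ‖ξ i‖ ^ 2 := by
  classical
  have key : ∀ a b : ℂ, ‖a‖ ^ 2 ≤ 2 * ‖a + b‖ ^ 2 + 2 * ‖b‖ ^ 2 := by
    intro a b
    have h := norm_sub_le (a + b) b
    rw [add_sub_cancel_right] at h
    nlinarith [sq_nonneg (‖a + b‖ - ‖b‖), norm_nonneg a]
  have h1 : ∀ j, G ‖y‖ ^ 2 * ‖ξ j‖ ^ 2 ≤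
      2 * ‖∑ i, ξ i * (G (dist (y + p j) (p i)) : ℂ)‖ ^ 2 +
      2 * (M * ∑ i ∈ Finset.univ.erase j, ‖ξ i‖ ^ 2 * G (dist (y + p j) (p i))) := by
    intro j
    rw [← Finset.add_sum_erase Finset.univ _ (Finset.mem_univ j)]
    refine le_trans ?_ ((key _ (∑ i ∈ Finset.univ.erase j,
      ξ i * (G (dist (y + p j) (p i)) : ℂ))).trans (add_le_add_right (mul_le_mul_of_nonneg_left
      (schur_cs (Finset.univ.erase j) ξ _ (fun i _ => hG0 _ dist_nonneg) M (hM _ _ ?_))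
        zero_le_two) _))
    · rw [norm_mul, Complex.norm_real, Real.norm_of_nonneg (hG0 _ dist_nonneg), mul_pow, mul_comm]
      simp
    · intro i hi
      have hne : j ≠ i := (Finset.ne_of_mem_erase hi).symm
      have h := hsep j i hne
      have t := dist_triangle_left (p j) (p i) (y + p j)
      have : dist (y + p j) (p j) = ‖y‖ := by simp
      linarith
  have h2 : ∑ j, ∑ i ∈ Finset.univ.erase j, ‖ξ i‖ ^ 2 * G (dist (y + p j) (p i)) ≤
      M * ∑ i, ‖ξ i‖ ^ 2 := by
    have : ∑ j, ∑ i ∈ Finset.univ.erase j, ‖ξ i‖ ^ 2 * G (dist (y + p j) (p i)) =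
        ∑ i, ∑ j ∈ Finset.univ.erase i, ‖ξ i‖ ^ 2 * G (dist (y + p j) (p i)) := by
      apply Finset.sum_comm'
      intro a b
      simp [eq_comm]
    rw [this, Finset.mul_sum]
    refine Finset.sum_le_sum fun i _ => ?_
    rw [← Finset.mul_sum, mul_comm]
    refine mul_le_mul_of_nonneg_right ?_ (by positivity)
    have hh : ∀ j, dist (y + p j) (p i) = dist (p i - y) (p j) := by
      intro j
      rw [dist_comm, dist_eq_norm, dist_eq_norm, sub_sub]
    simp_rw [hh]
    refine hM _ _ fun j hj => ?_
    have hne : i ≠ j := (Finset.ne_of_mem_erase hj).symm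
    have h := hsep i j hne
    have t := dist_triangle_left (p i) (p j) (p i - y)
    have : dist (p i - y) (p i) = ‖y‖ := by simp
    linarith
  have h3 := Finset.sum_le_sum fun j (_ : j ∈ Finset.univ) => h1 j
  rw [← Finset.mul_sum, Finset.sum_add_distrib, ← Finset.mul_sum, ← Finset.mul_sum,
    ← Finset.mul_sum] at h3
  nlinarith [mul_le_mul_of_nonneg_left h2 hM0]

lemma L2_norm_sq {F : E3 → ℂ} (f : Lp ℂ 2 (volume : Measure E3)) (h : f =ᵐ[volume] F) :
    ‖f‖ ^ 2 = ∫ x, ‖F x‖ ^ 2 := by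
  have h1 : ‖f‖ ^ 2 = RCLike.re (inner ℂ f f) := norm_sq_eq_re_inner f
  have h2 : (inner ℂ f f) = ((∫ x, ‖F x‖ ^ 2 : ℝ) : ℂ) := by
    rw [L2.inner_def, ← integral_complex_ofReal]
    refine integral_congr_ae ?_
    filter_upwards [h] with x hx
    rw [hx, inner_self_eq_norm_sq_to_K]
    simp
  rw [h1, h2]
  simp

lemma L2_integrable_sq {F : E3 → ℂ} (f : Lp ℂ 2 (volume : Measure E3)) (h : f =ᵐ[volume] F) :
    Integrable (fun x => ‖F x‖ ^ 2) := by
  have h0 : MemLp F 2 (volume : Measure E3) := (memLp_congr_ae h).1 (Lp.memLp f)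
  exact (memLp_two_iff_integrable_sq_norm h0.1).1 h0

lemma sum_ae (G : ℝ → ℝ) (X : ℕ → E3) (φ : ℕ → Lp ℂ 2 (volume : Measure E3))
    (hφ : ∀ j, (φ j : E3 → ℂ) =ᵐ[volume] fun x => (G (dist x (X j)) : ℂ)) (m : ℕ)
    (ξ : Fin m → ℂ) :
    ((∑ k, ξ k • φ (k : ℕ) : Lp ℂ 2 (volume : Measure E3)) : E3 → ℂ) =ᵐ[volume]
      fun x => ∑ k : Fin m, ξ k * (G (dist x (X k)) : ℂ) := by
  have h1 := Lp.coeFn_finsetSum Finset.univ (fun k : Fin m => ξ k • φ (k : ℕ))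
  have h2 : ∀ᵐ x, ∀ k : Fin m, (ξ k • φ (k : ℕ) : Lp ℂ 2 (volume : Measure E3)) x =
      ξ k * (G (dist x (X k)) : ℂ) := by
    rw [ae_all_iff]
    intro k
    filter_upwards [Lp.coeFn_smul (ξ k) (φ (k : ℕ)), hφ k] with x h3 h4
    rw [h3, Pi.smul_apply, h4, smul_eq_mul]
  filter_upwards [h1, h2] with x h3 h4
  rw [h3]
  simp [h4]

lemma backward (G : ℝ → ℝ) (hG0 : ∀ r, 0 ≤ r → 0 ≤ G r) (hanti : AntitoneOn G (Set.Ioi 0))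
    (hint : Integrable (fun x : E3 => G ‖x‖)) (κ : ℝ) (hκ : 0 < κ)
    (hlow : ∀ r, 0 < r → r ≤ 1 → κ / r ≤ G r)
    (X : ℕ → E3) (φ : ℕ → Lp ℂ 2 (volume : Measure E3))
    (hφ : ∀ j, (φ j : E3 → ℂ) =ᵐ[volume] fun x => (G (dist x (X j)) : ℂ))
    (hX : SeparatedSeq X) : IsRieszFischerSeq φ ∧ IsBesselSeq φ := by
  obtain ⟨d, hd, hsep⟩ := hX
  set M : ℝ := (∫ y : E3, G ‖y‖) / (volume : Measure E3).real (Metric.ball 0 (d / 4)) with hMdef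
  have hI0 : 0 ≤ ∫ y : E3, G ‖y‖ := integral_nonneg fun y => hG0 _ (norm_nonneg _)
  have hM0 : 0 ≤ M := by positivity
  have hsep' : ∀ m : ℕ, ∀ i j : Fin m, i ≠ j → d ≤ dist (X i) (X j) := fun m i j hij =>
    hsep _ _ (fun h => hij (Fin.ext h))
  have hM : ∀ (m : ℕ) (S : Finset (Fin m)) (x : E3), (∀ i ∈ S, d / 2 ≤ dist x (X i)) →
      ∑ i ∈ S, G (dist x (X i)) ≤ M := fun m S x hx =>
    far_sum_le G hG0 hanti hint d hd S (fun i : Fin m => X i) (fun i _ j _ => hsep' m i j) x hx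
  constructor
  · set ε : ℝ := min (min 1 (d / 2)) (κ / (2 * (M + 1))) with hε
    have hε0 : 0 < ε := by positivity
    have hε1 : ε ≤ 1 := (min_le_left _ _).trans (min_le_left _ _)
    have hε2 : ε ≤ d / 2 := (min_le_left _ _).trans (min_le_right _ _)
    have hε3 : ε ≤ κ / (2 * (M + 1)) := min_le_right _ _
    set v := (volume : Measure E3).real (Metric.ball 0 ε) with hvdef
    have hv : 0 < v := by
      rw [hvdef, Measure.real, ENNReal.toReal_pos_iff]
      exact ⟨Metric.measure_ball_pos _ _ hε0, measure_ball_lt_top⟩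
    refine ⟨v, hv, fun m ξ => ?_⟩
    have hae := sum_ae G X φ hφ m ξ
    rw [L2_norm_sq _ hae]
    have hFint := L2_integrable_sq _ hae
    set F : E3 → ℂ := fun x => ∑ k : Fin m, ξ k * (G (dist x (X k)) : ℂ) with hF
    set Ξ := ∑ k, ‖ξ k‖ ^ 2 with hΞ
    have hΞ0 : 0 ≤ Ξ := by positivity
    have hpt : ∀ y : E3, y ∈ Metric.ball (0 : E3) ε → y ≠ 0 →
        Ξ ≤ ∑ j : Fin m, ‖F (y + X j)‖ ^ 2 := by
      intro y hy hy0
      have hyn : 0 < ‖y‖ := norm_pos_iff.2 hy0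
      have hye : ‖y‖ < ε := by simpa using hy
      have h1 := pointwise_lower G hG0 d M m (fun i => X i) (hsep' m) (hM m) hM0 ξ y
        (hye.le.trans hε2)
      have h2 : 2 * (M + 1) ≤ G ‖y‖ := by
        refine le_trans ?_ (hlow _ hyn (hye.le.trans hε1))
        rw [le_div_iff₀ hyn]
        rw [le_div_iff₀ (by positivity)] at hε3
        nlinarith
      have h3 : 2 * M ^ 2 + 2 ≤ G ‖y‖ ^ 2 := by nlinarith
      have h4 := mul_le_mul_of_nonneg_right h3 hΞ0
      change G ‖y‖ ^ 2 * Ξ ≤ 2 * (∑ j : Fin m, ‖F (y + X j)‖ ^ 2) + 2 * M ^ 2 * Ξ at h1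
      linarith
    have hFtr : ∀ j : Fin m, Integrable (fun y => ‖F (y + X j)‖ ^ 2) := fun j =>
      hFint.comp_add_right (X j)
    calc v * Ξ = ∫ y in Metric.ball (0 : E3) ε, Ξ := by
          rw [setIntegral_const, smul_eq_mul]
      _ ≤ ∫ y in Metric.ball (0 : E3) ε, ∑ j : Fin m, ‖F (y + X j)‖ ^ 2 := by
          refine setIntegral_mono_on_ae (integrableOn_const (by exact measure_ball_lt_top.ne))
            (integrable_finsetSum _ fun j _ => (hFtr j).integrableOn) measurableSet_ball ?_
          filter_upwards [(Set.countable_singleton (0 : E3)).ae_notMem volume] with y hy hyb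
          exact hpt y hyb (by simpa using hy)
      _ = ∑ j : Fin m, ∫ y in Metric.ball (0 : E3) ε, ‖F (y + X j)‖ ^ 2 :=
          integral_finsetSum _ fun j _ => (hFtr j).integrableOn
      _ = ∑ j : Fin m, ∫ x in Metric.ball (X j) ε, ‖F x‖ ^ 2 := by
          refine Finset.sum_congr rfl fun j _ => ?_
          have := (measurePreserving_add_right (volume : Measure E3) (X j)).setIntegral_preimage_emb
            (measurableEmbedding_addRight (X j)) (fun x => ‖F x‖ ^ 2) (Metric.ball (X j) ε)
          rw [← this]
          simp
      _ = ∫ x in ⋃ j ∈ (Finset.univ : Finset (Fin m)), Metric.ball (X j) ε, ‖F x‖ ^ 2 := by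
          rw [integral_biUnion_finset _ (fun _ _ => measurableSet_ball) ?_
            (fun _ _ => hFint.integrableOn)]
          intro i _ j _ hij
          refine Metric.ball_disjoint_ball ?_
          have := hsep' m i j hij
          linarith
      _ ≤ ∫ x, ‖F x‖ ^ 2 :=
          setIntegral_le_integral hFint (Eventually.of_forall fun x => by positivity)
  · set A : ℝ := ∫ x : E3, G ‖x‖ ^ 2
    have hA0 : 0 ≤ A := integral_nonneg fun y => by positivity
    set I : ℝ := ∫ x : E3, G ‖x‖
    have hsq : Integrable (fun x : E3 => G ‖x‖ ^ 2) := by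
      have := (L2_integrable_sq _ (hφ 0)).comp_add_right (X 0)
      simpa [dist_eq_norm] using this
    refine ⟨2 * (A + M * I) + 1, by positivity, fun m ξ => ?_⟩
    have hae := sum_ae G X φ hφ m ξ
    rw [L2_norm_sq _ hae]
    have hFint := L2_integrable_sq _ hae
    have hk : ∀ a : E3, Integrable fun x : E3 =>
        2 * (G (dist x a) ^ 2 + M * G (dist x a)) := by
      intro a
      have h1 := hsq.comp_sub_right a
      have h2 := hint.comp_sub_right a
      simp only [dist_eq_norm]
      exact (h1.add (h2.const_mul M)).const_mul 2
    have hkI : ∀ a : E3, ∫ x : E3, 2 * (G (dist x a) ^ 2 + M * G (dist x a)) =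
        2 * (A + M * I) := by
      intro a
      simp only [dist_eq_norm]
      rw [integral_sub_right_eq_self (fun x : E3 => 2 * (G ‖x‖ ^ 2 + M * G ‖x‖)) a,
        integral_const_mul, integral_add hsq (hint.const_mul M), integral_const_mul]
    calc ∫ x, ‖∑ k : Fin m, ξ k * (G (dist x (X k)) : ℂ)‖ ^ 2
        ≤ ∫ x, ∑ i : Fin m, ‖ξ i‖ ^ 2 * (2 * (G (dist x (X i)) ^ 2 + M * G (dist x (X i)))) := by
          refine integral_mono hFint
            (integrable_finsetSum _ fun i _ => (hk (X i)).const_mul _) fun x => ?_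
          exact pointwise_upper G hG0 d M m (fun i => X i) (hsep' m) (hM m) hM0 ξ x
      _ = ∑ i : Fin m, ‖ξ i‖ ^ 2 * (2 * (A + M * I)) := by
          rw [integral_finsetSum Finset.univ fun (i : Fin m) _ => (hk (X i)).const_mul (‖ξ i‖ ^ 2)]
          refine Finset.sum_congr rfl fun i _ => ?_
          rw [integral_const_mul, hkI]
      _ = (2 * (A + M * I)) * ∑ i : Fin m, ‖ξ i‖ ^ 2 := by
          rw [← Finset.sum_mul, mul_comm]
      _ ≤ _ := by
          have : 0 ≤ ∑ i : Fin m, ‖ξ i‖ ^ 2 := by positivity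
          nlinarith

lemma forward (G : ℝ → ℝ)
    (X : ℕ → E3) (φ : ℕ → Lp ℂ 2 (volume : Measure E3))
    (hφ : ∀ j, (φ j : E3 → ℂ) =ᵐ[volume] fun x => (G (dist x (X j)) : ℂ))
    (hRF : IsRieszFischerSeq φ) : SeparatedSeq X := by
  obtain ⟨c, hc, hRF⟩ := hRF
  have htr : ∀ k j, φ k = DomAddAct.mk (X j - X k) +ᵥ φ j := by
    intro k j
    refine Lp.ext ?_
    have h1 := DomAddAct.vadd_Lp_ae_eq (DomAddAct.mk (X j - X k)) (φ j)
    have h2 := (measurePreserving_add_left (volume : Measure E3) (X j - X k)).quasiMeasurePreserving.ae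
      (hφ j)
    filter_upwards [h1, h2, hφ k] with x h3 h4 h5
    rw [h3, h5]
    simp only [Equiv.symm_apply_apply, vadd_eq_add]
    rw [h4]
    congr 2
    rw [dist_eq_norm, dist_eq_norm]
    congr 1
    abel
  have hpair : ∀ k j, k ≠ j → 2 * c ≤ ‖φ k - φ j‖ ^ 2 := by
    intro k j hkj
    set m := max k j + 1
    let k' : Fin m := ⟨k, by omega⟩
    let j' : Fin m := ⟨j, by omega⟩
    have hne : k' ≠ j' := fun h => hkj (congrArg Fin.val h)
    have h := hRF m (Pi.single k' 1 - Pi.single j' 1)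
    have e1 : ∑ i, (Pi.single k' 1 - Pi.single j' 1 : Fin m → ℂ) i • φ (i : ℕ) = φ k - φ j := by
      simp [sub_smul, Finset.sum_sub_distrib, Pi.single_apply, k', j']
    have e2 : ∑ i, ‖(Pi.single k' 1 - Pi.single j' 1 : Fin m → ℂ) i‖ ^ 2 = 2 := by
      have : ∀ i, ‖(Pi.single k' 1 - Pi.single j' 1 : Fin m → ℂ) i‖ ^ 2 =
          (if i = k' then 1 else 0) + (if i = j' then (1 : ℝ) else 0) := by
        intro i
        by_cases h1 : i = k'
        · subst h1; simp [hne]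
        · by_cases h2 : i = j'
          · subst h2; simp [h1]
          · simp [h1, h2]
      simp_rw [this, Finset.sum_add_distrib]
      norm_num
    rw [e1, e2] at h
    linarith
  have : Fact ((2 : ℝ≥0∞) ≠ ∞) := ⟨by norm_num⟩
  have hcont : Continuous fun a : E3 => DomAddAct.mk a +ᵥ φ 0 := by
    have : Continuous (DomAddAct.mk : E3 → E3ᵈᵃᵃ) := DomAddAct.continuous_mk
    fun_prop
  have h0 := (Metric.continuous_iff.1 hcont) 0 (Real.sqrt (2 * c)) (by positivity)
  obtain ⟨δ, hδ, h⟩ := h0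
  refine ⟨δ, hδ, fun k j hkj => ?_⟩
  by_contra hlt
  push Not at hlt
  have h1 := h (X j - X k) (by rw [dist_zero_right, ← dist_eq_norm, dist_comm]; exact hlt)
  have hj := htr j 0
  have hk : φ k = DomAddAct.mk (X 0 - X j) +ᵥ (DomAddAct.mk (X j - X k) +ᵥ φ 0) := by
    rw [← add_vadd, htr k 0]
    congr 1
    change DomAddAct.mk _ = DomAddAct.mk ((X j - X k) + (X 0 - X j))
    congr 1
    abel
  have hj' : φ j = DomAddAct.mk (X 0 - X j) +ᵥ (DomAddAct.mk (0 : E3) +ᵥ φ 0) := by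
    rw [DomAddAct.mk_zero, zero_vadd]
    exact htr j 0
  have h2 : dist (φ k) (φ j) < Real.sqrt (2 * c) := by
    rw [hk, hj', DomAddAct.dist_vadd_Lp]
    exact h1
  have h3 := hpair k j hkj
  rw [dist_eq_norm] at h2
  rw [Real.lt_sqrt (norm_nonneg _)] at h2
  linarith

/-- Let `τ` be a finite positive Borel measure on `[0,∞)` with
`τ((0,∞)) > 0` and `∫ (s + s⁻³) dτ(s) < ∞`, and let `X` be a sequence of pairwise distinct
points of `ℝ³`. Define `φ̃_j(x) = (2π)^{−1/2} ∫ e^{−s|x−x_j|}/|x−x_j| dτ(s)` in `L²(ℝ³)`.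
Then `{φ̃_j}` is a Riesz basis of the closure of its linear span (i.e. simultaneously a
Riesz–Fischer sequence and a Bessel sequence) iff `d_*(X) > 0`. -/
theorem statement_6 (τ : Measure ℝ) [IsFiniteMeasure τ]
    (hτneg : τ (Set.Iio 0) = 0) (hτpos : 0 < τ (Set.Ioi 0))
    (hmom : ∫⁻ s, (ENNReal.ofReal s + (ENNReal.ofReal s)⁻¹ ^ 3) ∂τ < ⊤)
    (X : ℕ → EuclideanSpace ℝ (Fin 3)) (hX : Function.Injective X)
    (φ : ℕ → Lp ℂ 2 (volume : Measure (EuclideanSpace ℝ (Fin 3))))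
    (hφ : ∀ j, (φ j : EuclideanSpace ℝ (Fin 3) → ℂ) =ᵐ[volume] fun x =>
      (((Real.sqrt (2 * Real.pi))⁻¹ *
        ∫ s, Real.exp (-(s * dist x (X j))) / dist x (X j) ∂τ : ℝ) : ℂ)) :
    (IsRieszFischerSeq φ ∧ IsBesselSeq φ) ↔ SeparatedSeq X := by
  have hpos : ∀ᵐ s ∂τ, 0 < s := by
    filter_upwards [ae_lt_top (by fun_prop) hmom.ne] with s hs
    by_contra h
    push Not at h
    simp [ENNReal.ofReal_of_nonpos h] at hs
  have hτ0 : τ ≠ 0 := by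
    rintro rfl
    simp at hτpos
  have hexp : ∀ r, 0 ≤ r → Integrable (fun s => Real.exp (-(s * r))) τ := by
    intro r hr
    refine Integrable.mono' (integrable_const (1 : ℝ)) (by fun_prop) ?_
    filter_upwards [hpos] with s hs
    rw [Real.norm_of_nonneg (Real.exp_pos _).le, Real.exp_le_one_iff]
    have := mul_nonneg hs.le hr
    linarith
  have hs3 : Integrable (fun s : ℝ => (s ^ 3)⁻¹) τ := by
    refine ⟨by fun_prop, ?_⟩
    refine lt_of_le_of_lt (lintegral_mono_ae ?_) hmom
    filter_upwards [hpos] with s hs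
    rw [Real.enorm_of_nonneg (by positivity), ENNReal.ofReal_inv_of_pos (by positivity),
      ENNReal.ofReal_pow hs.le, ENNReal.inv_pow]
    exact le_add_self
  set K : ℝ := ∫ s, (s ^ 3)⁻¹ ∂τ with hK
  set c0 : ℝ := (Real.sqrt (2 * Real.pi))⁻¹ with hc0
  have hc0pos : 0 < c0 := by positivity
  set L : ℝ → ℝ := fun r => ∫ s, Real.exp (-(s * r)) ∂τ with hL
  set G : ℝ → ℝ := fun r => c0 * ∫ s, Real.exp (-(s * r)) / r ∂τ with hG
  have hGL : ∀ r, G r = c0 * (L r / r) := by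
    intro r
    simp only [hG, hL, integral_div]
  have hL0 : ∀ r, 0 ≤ L r := fun r => integral_nonneg fun s => (Real.exp_pos _).le
  have hLanti : ∀ a b, 0 ≤ a → a ≤ b → L b ≤ L a := by
    intro a b ha hab
    refine integral_mono_ae (hexp b (ha.trans hab)) (hexp a ha) ?_
    filter_upwards [hpos] with s hs
    apply Real.exp_le_exp.2
    have := mul_le_mul_of_nonneg_left hab hs.le
    linarith
  have hL3 : ∀ r, 0 < r → L r ≤ 6 * K * (r ^ 3)⁻¹ := by
    intro r hr
    have : 6 * K * (r ^ 3)⁻¹ = ∫ s, (6 * (r ^ 3)⁻¹) * (s ^ 3)⁻¹ ∂τ := by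
      rw [integral_const_mul]; ring
    rw [this]
    refine integral_mono_ae (hexp r hr.le) (hs3.const_mul _) ?_
    filter_upwards [hpos] with s hs
    have h1 := Real.pow_div_factorial_le_exp (s * r) (by positivity) 3
    have h2 : ((Nat.factorial 3 : ℕ) : ℝ) = 6 := by norm_num [Nat.factorial]
    rw [h2] at h1
    rw [Real.exp_neg]
    have h3 : (6 * (r ^ 3)⁻¹) * (s ^ 3)⁻¹ = ((s * r) ^ 3 / 6)⁻¹ := by
      field_simp
    rw [h3]
    exact inv_anti₀ (by positivity) h1
  have hG0 : ∀ r, 0 ≤ r → 0 ≤ G r := by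
    intro r hr
    rw [hGL]
    have := hL0 r
    positivity
  have hanti : AntitoneOn G (Set.Ioi 0) := by
    intro a ha b hb hab
    rw [Set.mem_Ioi] at ha hb
    rw [hGL, hGL]
    have := hLanti a b ha.le hab
    have := hL0 a
    gcongr
  have hκ : 0 < c0 * L 1 := by
    refine mul_pos hc0pos ?_
    have : NeZero τ := ⟨hτ0⟩
    exact integral_exp_pos (hexp 1 zero_le_one)
  have hlow : ∀ r, 0 < r → r ≤ 1 → c0 * L 1 / r ≤ G r := by
    intro r hr hr1
    rw [hGL, mul_div_assoc]
    have := hLanti r 1 hr.le hr1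
    gcongr
  have hint : Integrable (fun x : E3 => G ‖x‖) := by
    rw [integrable_fun_norm_addHaar (volume : Measure E3) (f := G)]
    simp only [finrank_euclideanSpace, Fintype.card_fin, smul_eq_mul]
    have hmeas : AEStronglyMeasurable (fun y : ℝ => y ^ (3 - 1) * G y)
        (volume.restrict (Set.Ioi 0)) := by
      have : AEMeasurable G (volume.restrict (Set.Ioi 0)) :=
        aemeasurable_restrict_of_antitoneOn measurableSet_Ioi hanti
      exact ((by fun_prop : AEMeasurable (fun y : ℝ => y ^ (3 - 1)) _).mul this).aestronglyMeasurable
    have hval : ∀ r : ℝ, 0 < r → r ^ (3 - 1) * G r = c0 * (r * L r) := by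
      intro r hr
      rw [hGL, show 3 - 1 = 2 from rfl]
      field_simp
    rw [← Set.Ioc_union_Ioi_eq_Ioi (zero_le_one : (0 : ℝ) ≤ 1)] at hmeas ⊢
    refine IntegrableOn.union ?_ ?_
    · refine Integrable.mono' (g := fun _ => c0 * L 0) (integrableOn_const (by simp))
        (hmeas.mono_measure (Measure.restrict_mono Set.subset_union_left le_rfl)) ?_
      filter_upwards [ae_restrict_mem measurableSet_Ioc] with r hr
      have h1 := hL0 r
      have h2 := hLanti 0 r le_rfl hr.1.le
      have h3 := hr.1
      rw [hval r hr.1, Real.norm_of_nonneg (by positivity)]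
      have : r * L r ≤ 1 * L 0 := mul_le_mul hr.2 h2 h1 zero_le_one
      nlinarith
    · refine Integrable.mono' (g := fun r : ℝ => c0 * (6 * K) * r ^ (-2 : ℝ))
        ((integrableOn_Ioi_rpow_of_lt (by norm_num) one_pos).const_mul _)
        (hmeas.mono_measure (Measure.restrict_mono Set.subset_union_right le_rfl)) ?_
      filter_upwards [ae_restrict_mem measurableSet_Ioi] with r hr
      have h0 : 0 < r := lt_trans one_pos hr
      have h1 := hL0 r
      have h2 := hL3 r h0
      rw [hval r h0, Real.norm_of_nonneg (by positivity), mul_assoc]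
      refine mul_le_mul_of_nonneg_left ?_ hc0pos.le
      have h3 : r ^ (-2 : ℝ) = (r ^ 2)⁻¹ := by
        rw [Real.rpow_neg h0.le]; norm_cast
      rw [h3]
      calc r * L r ≤ r * (6 * K * (r ^ 3)⁻¹) := by gcongr
        _ = 6 * K * (r ^ 2)⁻¹ := by field_simp
  exact ⟨fun h => forward G X φ hφ h.1,
    fun h => backward G hG0 hanti hint _ hκ hlow X φ hφ h⟩
end
end
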